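/- arXiv:0911.3696 — 2 statements merged into one kernel-verified Lean document; each statement's English description precedes it below -/
import Mathlib

section
/- For every m ∈ ℕ, the Hochschild cohomology HH^m(S_q(V)) := Ext^m_{A^e}(A, A) is isomorphic as a k-vector space to the free k-vector space on the set { (α, β) ∈ ℕ^N × {0,1}^N : |β| = m and α − β ∈ C }; that is, HH^m(S_q(V)) ≅ ⊕_{β ∈ {0,1}^N, |β| = m} ⊕_{α ∈ ℕ^N, α−β ∈ C} span_k{ x^α ⊗ (x*)^{∧β} }. In particular it vanishes for m > N. -/
attribute [local instance] Classical.propDecidable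

set_option synthInstance.maxHeartbeats 1000000
set_option maxHeartbeats 1000000

noncomputable section

open scoped TensorProduct
open CategoryTheory

section QSA
variable (k : Type) [Field k] (N : ℕ) (q : Fin N → Fin N → k)

inductive QRel : FreeAlgebra k (Fin N) → FreeAlgebra k (Fin N) → Prop
  | rel (i j : Fin N) : QRel (FreeAlgebra.ι k i * FreeAlgebra.ι k j)
      (q i j • (FreeAlgebra.ι k j * FreeAlgebra.ι k i))

abbrev QSA := RingQuot (QRel k N q)

def X (i : Fin N) : QSA k N q := RingQuot.mkAlgHom k (QRel k N q) (FreeAlgebra.ι k i)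

abbrev QSAe := QSA k N q ⊗[k] (QSA k N q)ᵐᵒᵖ

instance : Module (QSAe k N q) (QSA k N q) := TensorProduct.Algebra.module

variable (lam : Fin N → k)

/-- The diagonal algebra automorphism `g` of `S_q(V)` with `g(x_i) = λ_i x_i`. -/
def gAlg : QSA k N q →ₐ[k] QSA k N q :=
  RingQuot.liftAlgHom k
    ⟨FreeAlgebra.lift k (fun i => lam i • X k N q i), by
      intro x y h
      induction h with
      | rel i j =>
        have hrel : (X k N q i) * (X k N q j) = q i j • ((X k N q j) * (X k N q i)) := by
          simpa only [X, map_mul, map_smul] using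
            RingQuot.mkAlgHom_rel k (QRel.rel (k := k) (N := N) (q := q) i j)
        simp only [map_mul, map_smul, FreeAlgebra.lift_ι_apply]
        rw [smul_mul_smul_comm, hrel, smul_smul]
        rw [smul_mul_smul_comm, smul_smul]
        congr 1
        ring⟩

/-- The algebra endomorphism `a ⊗ b^{op} ↦ a ⊗ (g b)^{op}` of `A^e`. -/
def taug : QSAe k N q →ₐ[k] QSAe k N q :=
  Algebra.TensorProduct.map (AlgHom.id k (QSA k N q)) (AlgHom.op (gAlg k N q lam))

/-- The twisted bimodule `A_g`: as a vector space it is `A`, with `A^e`-action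
`(a ⊗ b^{op}) · c = a c g(b)`. -/
def Ag (lam : Fin N → k) : Type := QSA k N q

instance : AddCommGroup (Ag k N q lam) := inferInstanceAs (AddCommGroup (QSA k N q))

instance : Module (QSAe k N q) (Ag k N q lam) :=
  Module.compHom (QSA k N q) (taug k N q lam).toRingHom

end QSA


section CgDef
variable (k : Type) [Field k] (N : ℕ) (q : Fin N → Fin N → k) (lam : Fin N → k)

/-- A subset `β ⊆ {1,…,N}`, considered as a `{0,1}`-vector in `ℤ^N`. -/
def betaZ (S : Finset (Fin N)) : Fin N → ℤ := fun s => if s ∈ S then 1 else 0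

/-- The set `C_g = {γ ∈ (ℕ ∪ {-1})^N : for each i, ∏_s q_{i,s}^{γ_s} = λ_i or γ_i = -1}`. -/
def Cg : Set (Fin N → ℤ) :=
  {γ | ∀ i : Fin N, (∏ s, q i s ^ γ s) = lam i ∨ γ i = -1}

/-- The Hochschild cohomology `HH^m(S_q(V), A_g) = Ext^m_{A^e}(A, A_g)`, as a
`k`-vector space (`Ext` taken in the category of left `A^e`-modules). -/
def HHg (m : ℕ) : ModuleCat k :=
  ((Ext k (ModuleCat (QSAe k N q)) m).obj
    (Opposite.op (ModuleCat.of (QSAe k N q) (QSA k N q)))).obj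
    (ModuleCat.of (QSAe k N q) (Ag k N q lam))

end CgDef

theorem homology_equiv {k : Type} [Field k] (S : ShortComplex (ModuleCat.{0} k)) (V : Type) [AddCommGroup V]
    [Module k V] (π : S.X₂ →ₗ[k] V) (h0 : ∀ x, π (S.f x) = 0)
    (hs : ∀ v, ∃ x, S.g x = 0 ∧ π x = v)
    (he : ∀ x, S.g x = 0 → π x = 0 → ∃ y, S.f y = x) : Nonempty (S.homology ≃ₗ[k] V) := by
  suffices h : Nonempty ((LinearMap.ker S.g.hom ⧸ LinearMap.range S.moduleCatToCycles) ≃ₗ[k] V) by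
    obtain ⟨e⟩ := h
    exact ⟨LinearEquiv.trans (M₂ := S.moduleCatLeftHomologyData.H)
      S.moduleCatHomologyIso.toLinearEquiv e⟩
  let π' : LinearMap.ker S.g.hom →ₗ[k] V := π.comp (LinearMap.ker S.g.hom).subtype
  have hk : LinearMap.range S.moduleCatToCycles = LinearMap.ker π' := by
    ext ⟨x, hx⟩
    constructor
    · rintro ⟨y, hy⟩
      have : S.f y = x := congrArg Subtype.val hy
      change π x = 0
      rw [← this, h0]
    · intro h
      obtain ⟨y, hy⟩ := he x hx h
      exact ⟨y, Subtype.ext hy⟩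
  have hsur : Function.Surjective π' := by
    intro v
    obtain ⟨x, hx, hv⟩ := hs v
    exact ⟨⟨x, hx⟩, hv⟩
  exact ⟨(Submodule.quotEquivOfEq _ _ hk).trans (π'.quotKerEquivOfSurjective hsur)⟩

section
variable {k R : Type} [Field k] [Ring R] [Algebra k R] (Z Y : Type) [AddCommGroup Z] [Module R Z]
  [AddCommGroup Y] [Module R Y] (ι : ℕ → Type)
  (d : ∀ p, (ι (p+1) →₀ R) →ₗ[R] (ι p →₀ R)) (ε : (ι 0 →₀ R) →ₗ[R] Z)

def theComplex (hd : ∀ p x, d p (d (p+1) x) = 0) : ChainComplex (ModuleCat.{0} R) ℕ :=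
  ChainComplex.of (fun p => ModuleCat.of R (ι p →₀ R)) (fun p => ModuleCat.ofHom (d p))
    (fun p => by ext1; exact LinearMap.ext (fun x => hd p x))

theorem theComplex_d (hd : ∀ p x, d p (d (p+1) x) = 0) (n : ℕ) :
    (theComplex ι d hd).d (n+1) n = ModuleCat.ofHom (d n) :=
  ChainComplex.of_d (fun p => ModuleCat.of R (ι p →₀ R)) (fun p => ModuleCat.ofHom (d p)) n

def theRes (hd : ∀ p x, d p (d (p+1) x) = 0) (hε : ∀ x, ε (d 0 x) = 0)
    (hsurj : Function.Surjective ε) (hex0 : ∀ x, ε x = 0 → ∃ y, d 0 y = x)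
    (hex : ∀ p x, d p x = 0 → ∃ y, d (p+1) y = x) :
    ProjectiveResolution (ModuleCat.of R Z) where
  complex := theComplex ι d hd
  projective n := by
    change Projective (ModuleCat.of R (ι n →₀ R))
    rw [← IsProjective.iff_projective]
    infer_instance
  π := (ChainComplex.toSingle₀Equiv _ _).symm ⟨ModuleCat.ofHom ε, by
    have h : (theComplex ι d hd).d 1 0 = ModuleCat.ofHom (d 0) := theComplex_d ι d hd 0
    rw [h]
    ext1; exact LinearMap.ext (fun x => hε x)⟩
  quasiIso := ⟨fun n => by
    cases n
    · rw [ChainComplex.quasiIsoAt₀_iff, ShortComplex.quasiIso_iff_of_zeros']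
      · let T : ShortComplex (ModuleCat.{0} R) := ShortComplex.mk (ModuleCat.ofHom (d 0)) (ModuleCat.ofHom ε)
          (by ext1; exact LinearMap.ext (fun x => hε x))
        have hT : T.Exact ∧ Epi T.g := by
          constructor
          · rw [ShortComplex.moduleCat_exact_iff]
            exact hex0
          · exact (ModuleCat.epi_iff_surjective _).2 hsurj
        refine (ShortComplex.exact_and_epi_g_iff_of_iso ?_).2 hT
        exact ShortComplex.isoMk (Iso.refl _) (Iso.refl _) (Iso.refl _)
          (by
            have h := theComplex_d ι d hd 0
            simp only [T]
            erw [Category.id_comp]) (by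
            erw [Category.id_comp])
      all_goals rfl
    · rename_i n
      rw [quasiIsoAt_iff_exactAt']
      · rw [HomologicalComplex.exactAt_iff' _ (n + 1 + 1) (n + 1) n (by simp) (by simp)]
        rw [ShortComplex.moduleCat_exact_iff]
        have h1 : (theComplex ι d hd).d (n+1) n = ModuleCat.ofHom (d n) := theComplex_d _ _ _ _
        have h2 : (theComplex ι d hd).d (n+1+1) (n+1) = ModuleCat.ofHom (d (n+1)) := theComplex_d _ _ _ _
        intro x hx
        change ((theComplex ι d hd).d (n+1) n) x = 0 at hx
        rw [h1] at hx
        obtain ⟨y, hy⟩ := hex n x hx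
        refine ⟨y, ?_⟩
        change ((theComplex ι d hd).d (n+1+1) (n+1)) y = x
        rw [h2]
        exact hy
      · apply ChainComplex.exactAt_succ_single_obj⟩

theorem ext_compute (hd : ∀ p x, d p (d (p+1) x) = 0) (hε : ∀ x, ε (d 0 x) = 0)
    (hsurj : Function.Surjective ε) (hex0 : ∀ x, ε x = 0 → ∃ y, d 0 y = x)
    (hex : ∀ p x, d p x = 0 → ∃ y, d (p+1) y = x) (m : ℕ)
    (V : Type) [AddCommGroup V] [Module k V] (π : ((ι m →₀ R) →ₗ[R] Y) → V)
    (hadd : ∀ f g, π (f + g) = π f + π g)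
    (hsmul : ∀ (c : k) f g, (∀ x, g x = algebraMap k R c • f x) → π g = c • π f)
    (h0 : ∀ n (h : n + 1 = m) (f : (ι n →₀ R) →ₗ[R] Y), π (h ▸ (f.comp (d n))) = 0)
    (hs : ∀ v, ∃ f, f.comp (d m) = 0 ∧ π f = v)
    (he0 : m = 0 → ∀ f, f.comp (d m) = 0 → π f = 0 → f = 0)
    (he : ∀ n (h : n + 1 = m) f, f.comp (d m) = 0 → π f = 0 → ∃ g : (ι n →₀ R) →ₗ[R] Y,
      (h ▸ (g.comp (d n))) = f) :
    Nonempty (((Ext k (ModuleCat.{0} R) m).obj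
        (Opposite.op (ModuleCat.of R Z))).obj (ModuleCat.of R Y) ≃ₗ[k] V) := by
  let P := theRes Z ι d ε hd hε hsurj hex0 hex
  let C := P.complex.linearYonedaObj k (ModuleCat.of R Y)
  suffices h : Nonempty (C.homology m ≃ₗ[k] V) by
    obtain ⟨e⟩ := h
    exact ⟨(P.isoExt m (ModuleCat.of R Y)).toLinearEquiv.trans e⟩
  have hCd : ∀ n (f : ModuleCat.of R (ι n →₀ R) ⟶ ModuleCat.of R Y),
      (C.d n (n+1)) f = ModuleCat.ofHom (d n) ≫ f := by
    intro n f
    have : P.complex.d (n+1) n = ModuleCat.ofHom (d n) := theComplex_d _ _ hd _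
    change P.complex.d (n+1) n ≫ f = _
    rw [this]
    rfl
  let π' : C.X m →ₗ[k] V :=
    { toFun := fun f => π (ModuleCat.Hom.hom (A := ModuleCat.of R (ι m →₀ R)) (B := ModuleCat.of R Y) f)
      map_add' := fun f g => hadd _ _
      map_smul' := fun c f => hsmul c _ _ (fun x => rfl) }
  have hs' : ∀ v, ∃ x, (C.d m (m+1)) x = 0 ∧ π' x = v := by
    intro v
    obtain ⟨f, hf, hv⟩ := hs v
    refine ⟨ModuleCat.ofHom f, ?_, hv⟩
    rw [hCd]
    exact ModuleCat.hom_ext hf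
  have hz : ∀ x, (C.d m (m+1)) x = 0 → (ModuleCat.Hom.hom (A := ModuleCat.of R (ι m →₀ R)) (B := ModuleCat.of R Y) x).comp (d m) = 0 := by
    intro x hx
    have hx := (hCd m x).symm.trans hx
    exact congrArg ModuleCat.Hom.hom hx
  cases m with
  | zero =>
    have := homology_equiv (C.sc' 0 0 1) V π' (by
      intro x
      have : C.d 0 0 = 0 := C.shape _ _ (by simp)
      change π' (C.d 0 0 x) = 0
      rw [this]
      exact map_zero π') hs' (by
      intro x hx hp
      refine ⟨0, ?_⟩
      rw [map_zero]
      exact (ModuleCat.hom_ext (he0 rfl _ (hz x hx) hp)).symm)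
    obtain ⟨e⟩ := this
    exact ⟨(C.homologyIsoSc' 0 0 1 (by simp) (by simp)).toLinearEquiv.trans e⟩
  | succ n =>
    have := homology_equiv (C.sc' n (n+1) (n+1+1)) V π' (by
      intro x
      change π' (C.d n (n+1) x) = 0
      exact (congrArg π' (hCd n x)).trans (h0 n rfl _)) hs' (by
      intro x hx hp
      obtain ⟨g, hg⟩ := he n rfl _ (hz x hx) hp
      refine ⟨ModuleCat.ofHom g, ?_⟩
      change C.d n (n+1) (ModuleCat.ofHom g) = x
      rw [hCd]
      exact ModuleCat.hom_ext hg)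
    obtain ⟨e⟩ := this
    exact ⟨(C.homologyIsoSc' n (n+1) (n+1+1) (by simp) (by simp)).toLinearEquiv.trans e⟩
end

section bichar
variable {k : Type} [Field k] {N : ℕ} (q : Fin N → Fin N → k)

def rr (i j : Fin N) : k := if j < i then q i j else 1

/-- The bicharacter. -/
def sg (a b : Fin N → ℤ) : k := ∏ i, ∏ j, rr q i j ^ (a i * b j)

def cN (a : Fin N → ℕ) : Fin N → ℤ := fun i => (a i : ℤ)

/-- unit vectors -/
def eN (i : Fin N) : Fin N → ℕ := Pi.single i 1

@[simp] theorem cN_add (a b : Fin N → ℕ) : cN (a + b) = cN a + cN b := by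
  funext i; simp [cN]
@[simp] theorem cN_zero : cN (0 : Fin N → ℕ) = 0 := by
  funext i; simp [cN]

theorem rr_ne (hq0 : ∀ i j, q i j ≠ 0) (i j) : rr q i j ≠ 0 := by
  unfold rr; split_ifs <;> simp [hq0]

theorem sg_ne (hq0 : ∀ i j, q i j ≠ 0) (a b) : sg q a b ≠ 0 := by
  unfold sg
  refine Finset.prod_ne_zero_iff.2 fun i _ => Finset.prod_ne_zero_iff.2 fun j _ => ?_
  exact zpow_ne_zero _ (rr_ne q hq0 i j)

theorem sg_add_left (hq0 : ∀ i j, q i j ≠ 0) (a b c) : sg q (a + b) c = sg q a c * sg q b c := by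
  simp only [sg, ← Finset.prod_mul_distrib]
  refine Finset.prod_congr rfl fun i _ => Finset.prod_congr rfl fun j _ => ?_
  rw [← zpow_add₀ (rr_ne q hq0 i j), Pi.add_apply, add_mul]

theorem sg_add_right (hq0 : ∀ i j, q i j ≠ 0) (a b c) : sg q a (b + c) = sg q a b * sg q a c := by
  simp only [sg, ← Finset.prod_mul_distrib]
  refine Finset.prod_congr rfl fun i _ => Finset.prod_congr rfl fun j _ => ?_
  rw [← zpow_add₀ (rr_ne q hq0 i j), Pi.add_apply, mul_add]

@[simp] theorem sg_zero_left (a) : sg q 0 a = 1 := by simp [sg]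
@[simp] theorem sg_zero_right (a) : sg q a 0 = 1 := by simp [sg]

theorem sg_unit_left (i : Fin N) (γ) : sg q (cN (eN i)) γ = ∏ j, rr q i j ^ γ j := by
  unfold sg
  rw [Finset.prod_eq_single i]
  · simp [cN, eN]
  · intro b _ hb
    simp [cN, eN, hb]
  · simp

theorem sg_unit_right (i : Fin N) (γ) : sg q γ (cN (eN i)) = ∏ j, rr q j i ^ γ j := by
  unfold sg
  refine Finset.prod_congr rfl fun j _ => ?_
  rw [Finset.prod_eq_single i]
  · simp [cN, eN]
  · intro b _ hb
    simp [cN, eN, hb]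
  · simp

theorem rr_swap (hq0 : ∀ i j, q i j ≠ 0) (hq1 : ∀ i, q i i = 1)
    (hqinv : ∀ i j, q j i = (q i j)⁻¹) (i j) : rr q i j = q i j * rr q j i := by
  unfold rr
  rcases lt_trichotomy i j with h | h | h
  · rw [if_neg h.not_gt, if_pos h, hqinv i j, mul_inv_cancel₀ (hq0 _ _)]
  · subst h; simp [hq1]
  · rw [if_pos h, if_neg h.not_gt, mul_one]

theorem sg_swap (hq0 : ∀ i j, q i j ≠ 0) (hq1 : ∀ i, q i i = 1)
    (hqinv : ∀ i j, q j i = (q i j)⁻¹) (i γ) :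
    sg q (cN (eN i)) γ = (∏ s, q i s ^ γ s) * sg q γ (cN (eN i)) := by
  rw [sg_unit_left, sg_unit_right, ← Finset.prod_mul_distrib]
  refine Finset.prod_congr rfl fun j _ => ?_
  rw [rr_swap q hq0 hq1 hqinv, mul_zpow]

theorem sg_ee (hq0 : ∀ i j, q i j ≠ 0) (hq1 : ∀ i, q i i = 1)
    (hqinv : ∀ i j, q j i = (q i j)⁻¹) (i j) :
    sg q (cN (eN i)) (cN (eN j)) = q i j * sg q (cN (eN j)) (cN (eN i)) := by
  rw [sg_swap q hq0 hq1 hqinv]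
  congr 1
  rw [Finset.prod_eq_single j]
  · simp [cN, eN]
  · intro b _ hb
    simp [cN, eN, hb]
  · simp

theorem sg_eq_iff (hq0 : ∀ i j, q i j ≠ 0) (hq1 : ∀ i, q i i = 1)
    (hqinv : ∀ i j, q j i = (q i j)⁻¹) (i γ) :
    sg q (cN (eN i)) γ - sg q γ (cN (eN i)) = 0 ↔ (∏ s, q i s ^ γ s) = 1 := by
  rw [sg_swap q hq0 hq1 hqinv, sub_eq_zero]
  exact mul_eq_right₀ (sg_ne q hq0 _ _)

end bichar

section pbw
variable {k : Type} [Field k] {N : ℕ} (q : Fin N → Fin N → k)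

theorem X_rel (i j : Fin N) : X k N q i * X k N q j = q i j • (X k N q j * X k N q i) := by
  simpa only [X, map_mul, map_smul] using
    RingQuot.mkAlgHom_rel k (QRel.rel (k := k) (N := N) (q := q) i j)

def ldeg (w : List (Fin N)) : Fin N → ℕ := fun i => w.count i

theorem ldeg_nil : ldeg ([] : List (Fin N)) = 0 := by funext i; simp [ldeg]
theorem ldeg_cons (i : Fin N) (w) : ldeg (i :: w) = ldeg w + eN i := by
  funext j; simp only [ldeg, eN, Pi.add_apply, List.count_cons, Pi.single_apply, beq_iff_eq]
  by_cases h : i = j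
  · subst h; simp
  · simp [h, Ne.symm h]

/-- normalized word -/
def pw : List (Fin N) → QSA k N q
  | [] => 1
  | i :: w => (sg q (cN (eN i)) (cN (ldeg w)))⁻¹ • (X k N q i * pw w)

theorem ldeg_perm {w v : List (Fin N)} (h : w.Perm v) : ldeg w = ldeg v := by
  funext i; exact h.count_eq i

theorem pw_perm (hq0 : ∀ i j, q i j ≠ 0) (hq1 : ∀ i, q i i = 1)
    (hqinv : ∀ i j, q j i = (q i j)⁻¹) {w v : List (Fin N)} (h : w.Perm v) : pw q w = pw q v := by
  induction h with
  | nil => rfl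
  | cons x h ih => simp only [pw]; rw [ih, ldeg_perm h]
  | swap x y l =>
    simp only [pw, ldeg_cons, cN_add, sg_add_right q hq0, mul_smul_comm, smul_smul, ← mul_assoc]
    rw [X_rel q y x, smul_mul_assoc, smul_smul, sg_ee q hq0 hq1 hqinv y x]
    congr 1
    have := hq0 y x
    have := sg_ne q hq0 (cN (eN x)) (cN (eN y))
    have := sg_ne q hq0 (cN (eN x)) (cN (ldeg l))
    have := sg_ne q hq0 (cN (eN y)) (cN (ldeg l))
    field_simp
  | trans _ _ h1 h2 => exact h1.trans h2

def wd (a : Fin N → ℕ) : List (Fin N) := (List.finRange N).flatMap (fun i => List.replicate (a i) i)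

theorem ldeg_wd (a : Fin N → ℕ) : ldeg (wd a) = a := by
  funext i
  simp only [ldeg, wd, List.count_flatMap]
  have : (List.count i ∘ fun i => List.replicate (a i) i) = fun j => if j = i then a i else 0 := by
    funext j
    simp only [Function.comp, List.count_replicate, beq_iff_eq]
    split_ifs with h
    · rw [h]
    · rfl
  rw [this, ← List.sum_toFinset _ (List.nodup_finRange N)]
  simp

def mono (a : Fin N → ℕ) : QSA k N q := pw q (wd a)

theorem pw_eq (hq0 : ∀ i j, q i j ≠ 0) (hq1 : ∀ i, q i i = 1)
    (hqinv : ∀ i j, q j i = (q i j)⁻¹) (w) : pw q w = mono q (ldeg w) := by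
  apply pw_perm q hq0 hq1 hqinv
  rw [List.perm_iff_count]
  intro a
  exact (congrFun (ldeg_wd (ldeg w)) a).symm

theorem mono_zero (hq0 : ∀ i j, q i j ≠ 0) (hq1 : ∀ i, q i i = 1)
    (hqinv : ∀ i j, q j i = (q i j)⁻¹) : mono q 0 = 1 := by
  rw [← ldeg_nil, ← pw_eq q hq0 hq1 hqinv]; rfl

theorem X_mono (hq0 : ∀ i j, q i j ≠ 0) (hq1 : ∀ i, q i i = 1)
    (hqinv : ∀ i j, q j i = (q i j)⁻¹) (i a) :
    X k N q i * mono q a = sg q (cN (eN i)) (cN a) • mono q (a + eN i) := by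
  have h := pw_eq q hq0 hq1 hqinv (i :: wd a)
  rw [ldeg_cons, ldeg_wd] at h
  rw [← h]
  simp only [pw, ldeg_wd]
  rw [smul_smul, mul_inv_cancel₀ (sg_ne q hq0 _ _), one_smul]; rfl

theorem mono_mul (hq0 : ∀ i j, q i j ≠ 0) (hq1 : ∀ i, q i i = 1)
    (hqinv : ∀ i j, q j i = (q i j)⁻¹) (a b) :
    mono q a * mono q b = sg q (cN a) (cN b) • mono q (a + b) := by
  have : ∀ w, mono q (ldeg w) * mono q b = sg q (cN (ldeg w)) (cN b) • mono q (ldeg w + b) := by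
    intro w
    induction w with
    | nil => simp [ldeg_nil, mono_zero q hq0 hq1 hqinv]
    | cons i w ih =>
      rw [← pw_eq q hq0 hq1 hqinv]
      simp only [pw]
      rw [smul_mul_assoc, mul_assoc, pw_eq q hq0 hq1 hqinv w, ih, mul_smul_comm,
        X_mono q hq0 hq1 hqinv, smul_smul, smul_smul, ldeg_cons, add_right_comm]
      congr 1
      simp only [cN_add, sg_add_right q hq0, sg_add_left q hq0]
      have := sg_ne q hq0 (cN (eN i)) (cN (ldeg w))
      field_simp
  simpa only [ldeg_wd] using this (wd a)

/-- the left regular representation on the monomial space -/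
def phiX (i : Fin N) : Module.End k ((Fin N → ℕ) →₀ k) :=
  Finsupp.linearCombination k (fun a => sg q (cN (eN i)) (cN a) • Finsupp.single (a + eN i) (1 : k))

theorem phiX_single (i : Fin N) (a c) : phiX q i (Finsupp.single a c) =
    Finsupp.single (a + eN i) (c * sg q (cN (eN i)) (cN a)) := by
  simp [phiX]

def phi (hq0 : ∀ i j, q i j ≠ 0) (hq1 : ∀ i, q i i = 1)
    (hqinv : ∀ i j, q j i = (q i j)⁻¹) : QSA k N q →ₐ[k] Module.End k ((Fin N → ℕ) →₀ k) :=
  RingQuot.liftAlgHom k ⟨FreeAlgebra.lift k (phiX q), by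
    intro x y h
    induction h with
    | rel i j =>
      simp only [map_mul, map_smul, FreeAlgebra.lift_ι_apply]
      ext1 a
      ext1
      simp only [LinearMap.comp_apply, Module.End.mul_apply, LinearMap.smul_apply,
        Finsupp.lsingle_apply, phiX_single, Finsupp.smul_single, add_right_comm]
      congr 1
      simp only [cN_add, sg_add_right q hq0, smul_eq_mul]
      rw [sg_ee q hq0 hq1 hqinv i j]
      ring⟩

theorem phi_X (hq0 : ∀ i j, q i j ≠ 0) (hq1 : ∀ i, q i i = 1)
    (hqinv : ∀ i j, q j i = (q i j)⁻¹) (i) : phi q hq0 hq1 hqinv (X k N q i) = phiX q i := by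
  simp [phi, X]

def psi : ((Fin N → ℕ) →₀ k) →ₗ[k] QSA k N q := Finsupp.linearCombination k (mono q)

theorem QSA_induction (P : QSA k N q → Prop) (h1 : ∀ c : k, P (algebraMap k _ c))
    (hX : ∀ i, P (X k N q i)) (ha : ∀ x y, P x → P y → P (x + y))
    (hm : ∀ x y, P x → P y → P (x * y)) (x) : P x := by
  obtain ⟨y, rfl⟩ := RingQuot.mkAlgHom_surjective k (QRel k N q) x
  induction y using FreeAlgebra.induction with
  | grade0 r => rw [AlgHom.commutes]; exact h1 r
  | grade1 i => exact hX i
  | mul a b h1 h2 => rw [map_mul]; exact hm _ _ h1 h2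
  | add a b h1 h2 => rw [map_add]; exact ha _ _ h1 h2

theorem psi_phi (hq0 : ∀ i j, q i j ≠ 0) (hq1 : ∀ i, q i i = 1)
    (hqinv : ∀ i j, q j i = (q i j)⁻¹) (x) :
    ∀ m, psi q (phi q hq0 hq1 hqinv x m) = x * psi q m := by
  induction x using QSA_induction with
  | h1 c => intro m; rw [AlgHom.commutes, Algebra.algebraMap_eq_smul_one, Algebra.algebraMap_eq_smul_one]
            simp
  | hX i =>
    intro m
    rw [phi_X]
    induction m using Finsupp.induction_linear with
    | zero => simp
    | add f g hf hg => simp only [map_add, hf, hg, mul_add]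
    | single a c =>
      rw [phiX_single]
      simp only [psi, Finsupp.linearCombination_single]
      rw [mul_smul_comm, X_mono q hq0 hq1 hqinv, smul_smul]
  | ha x y h1 h2 => intro m; rw [map_add, LinearMap.add_apply, map_add, h1, h2, add_mul]
  | hm x y h1 h2 => intro m; rw [map_mul, Module.End.mul_apply, h1, h2, mul_assoc]

theorem qsa_basis (hq0 : ∀ i j, q i j ≠ 0) (hq1 : ∀ i, q i i = 1)
    (hqinv : ∀ i j, q j i = (q i j)⁻¹) : ∃ (B : Module.Basis (Fin N → ℕ) k (QSA k N q)), B 0 = 1 ∧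
    (∀ a b, B a * B b = sg q (cN a) (cN b) • B (a + b)) := by
  let θ : QSA k N q →ₗ[k] ((Fin N → ℕ) →₀ k) :=
    (LinearMap.applyₗ (Finsupp.single 0 1)).comp (phi q hq0 hq1 hqinv).toLinearMap
  have hθ : ∀ x, θ x = phi q hq0 hq1 hqinv x (Finsupp.single 0 1) := fun x => rfl
  have h1 : ∀ x, psi q (θ x) = x := by
    intro x
    rw [hθ, psi_phi]
    simp [psi, mono_zero q hq0 hq1 hqinv]
  have h2 : ∀ w, θ (pw q w) = Finsupp.single (ldeg w) 1 := by
    intro w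
    induction w with
    | nil => rw [hθ]; simp [pw, ldeg_nil]
    | cons i w ih =>
      rw [hθ] at ih ⊢
      simp only [pw, map_smul, map_mul, LinearMap.smul_apply, Module.End.mul_apply, ih, phi_X,
        phiX_single, ldeg_cons]
      rw [Finsupp.smul_single, smul_eq_mul, one_mul, inv_mul_cancel₀ (sg_ne q hq0 _ _)]
  have h3 : ∀ m, θ (psi q m) = m := by
    intro m
    induction m using Finsupp.induction_linear with
    | zero => simp
    | add f g hf hg => simp only [map_add, hf, hg]
    | single a c =>
      simp only [psi, Finsupp.linearCombination_single, map_smul]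
      rw [mono, h2, ldeg_wd]; simp
  let e : QSA k N q ≃ₗ[k] ((Fin N → ℕ) →₀ k) :=
    LinearEquiv.ofLinear θ (psi q) (LinearMap.ext h3) (LinearMap.ext h1)
  have hB : ∀ a, (Module.Basis.ofRepr e) a = mono q a := by
    intro a
    change psi q (Finsupp.single a 1) = _
    simp [psi]
  refine ⟨Module.Basis.ofRepr e, ?_, ?_⟩
  · rw [hB, mono_zero q hq0 hq1 hqinv]
  · intro a b
    rw [hB, hB, hB, mono_mul q hq0 hq1 hqinv]
end pbw

section koszul
variable {k : Type} [Field k] {N : ℕ}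

/-- Koszul sign -/
def ksgn (k : Type) [Field k] {N : ℕ} (i : Fin N) (S : Finset (Fin N)) : k :=
  (-1) ^ (S.filter (· < i)).card

theorem ksgn_sq (i : Fin N) (S : Finset (Fin N)) : ksgn k i S * ksgn k i S = 1 := by
  rw [ksgn, ← mul_pow]; simp

theorem ksgn_insert_self (i : Fin N) (S : Finset (Fin N)) : ksgn k i (insert i S) = ksgn k i S := by
  simp [ksgn, Finset.filter_insert]

theorem ksgn_erase_self (i : Fin N) (S : Finset (Fin N)) : ksgn k i (S.erase i) = ksgn k i S := by
  simp [ksgn, Finset.filter_erase]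

theorem ksgn_insert (i j : Fin N) (S : Finset (Fin N)) (hj : j ∉ S) :
    ksgn k i (insert j S) = (if j < i then -1 else 1) * ksgn k i S := by
  simp only [ksgn, Finset.filter_insert]
  split_ifs with h
  · rw [Finset.card_insert_of_notMem (by simp [hj]), pow_succ]; ring
  · simp

theorem ksgn_erase (i j : Fin N) (S : Finset (Fin N)) (hj : j ∈ S) :
    ksgn k i (S.erase j) = (if j < i then -1 else 1) * ksgn k i S := by
  have := ksgn_insert (k := k) i j (S.erase j) (by simp)
  rw [Finset.insert_erase hj] at this
  rw [this, ← mul_assoc]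
  split_ifs <;> simp

/-- the sign rule for two different removals -/
theorem ksgn_erase_erase (i j : Fin N) (S : Finset (Fin N)) (hij : i ≠ j) (hi : i ∈ S) (hj : j ∈ S) :
    ksgn k i S * ksgn k j (S.erase i) = - (ksgn k j S * ksgn k i (S.erase j)) := by
  rw [ksgn_erase j i S hi, ksgn_erase i j S hj]
  rcases lt_or_gt_of_ne hij with h | h
  · rw [if_pos h, if_neg h.not_gt]; ring
  · rw [if_pos h, if_neg h.not_gt]; ring

theorem ksgn_insert_erase (i j : Fin N) (S : Finset (Fin N)) (hij : i ≠ j) (hi : i ∉ S) (hj : j ∈ S) :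
    ksgn k i S * ksgn k j (insert i S) = - (ksgn k j S * ksgn k i (S.erase j)) := by
  rw [ksgn_insert j i S hi, ksgn_erase i j S hj]
  rcases lt_or_gt_of_ne hij with h | h
  · rw [if_pos h, if_neg h.not_gt]; ring
  · rw [if_pos h, if_neg h.not_gt]; ring

variable {V : Type} [AddCommGroup V] [Module k V]
  (b : Module.Basis ((Fin N → ℕ) × Finset (Fin N) × (Fin N → ℕ)) k V)

def kD (j : Fin N) : V →ₗ[k] V := b.constr k (fun x =>
  if j ∈ x.2.1 then ksgn k j x.2.1 • (b (x.1 + eN j, x.2.1.erase j, x.2.2) -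
    b (x.1, x.2.1.erase j, x.2.2 + eN j)) else 0)

def kH (i : Fin N) : V →ₗ[k] V := b.constr k (fun x =>
  if i ∈ x.2.1 then 0 else ksgn k i x.2.1 • (-∑ t ∈ Finset.range (x.2.2 i),
    b (x.1 + t • eN i, insert i x.2.1, x.2.2 - (t + 1) • eN i)))

def kP (i : Fin N) : V →ₗ[k] V := b.constr k (fun x =>
  if i ∈ x.2.1 then 0 else b (x.1 + x.2.2 i • eN i, x.2.1, x.2.2 - x.2.2 i • eN i))

theorem kD_b (j a S c) : kD b j (b (a, S, c)) = if j ∈ S then ksgn k j S •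
    (b (a + eN j, S.erase j, c) - b (a, S.erase j, c + eN j)) else 0 := by
  rw [kD, Module.Basis.constr_basis]

theorem kH_b (i a S c) : kH b i (b (a, S, c)) = if i ∈ S then 0 else ksgn k i S •
    (-∑ t ∈ Finset.range (c i), b (a + t • eN i, insert i S, c - (t + 1) • eN i)) := by
  rw [kH, Module.Basis.constr_basis]

theorem kP_b (i a S c) : kP b i (b (a, S, c)) = if i ∈ S then 0 else
    b (a + c i • eN i, S, c - c i • eN i) := by
  rw [kP, Module.Basis.constr_basis]

theorem kD_kD (i j : Fin N) : kD b i ∘ₗ kD b j + kD b j ∘ₗ kD b i = 0 := by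
  refine b.ext ?_
  rintro ⟨a, S, c⟩
  simp only [LinearMap.add_apply, LinearMap.comp_apply, LinearMap.zero_apply]
  by_cases hij : i = j
  · subst hij
    rw [kD_b]
    split_ifs with h
    · simp [kD_b]
    · simp
  by_cases hi : i ∈ S <;> by_cases hj : j ∈ S
  · rw [kD_b, kD_b, if_pos hi, if_pos hj]
    simp only [map_smul, map_sub, kD_b, Finset.mem_erase, hij, Ne.symm hij, hi, hj, ne_eq,
      not_false_eq_true, and_self, if_true]
    rw [Finset.erase_right_comm (a := j) (b := i), ← smul_sub, ← smul_sub, smul_smul, smul_smul,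
      ksgn_erase_erase i j S hij hi hj, add_right_comm a (eN j), add_right_comm c (eN j)]
    module
  · simp [kD_b, hi, hj]
  · simp [kD_b, hi, hj]
  · simp [kD_b, hi, hj]

theorem kH_kD_ne (i j : Fin N) (hij : i ≠ j) : kD b j ∘ₗ kH b i + kH b i ∘ₗ kD b j = 0 := by
  refine b.ext ?_
  rintro ⟨a, S, c⟩
  simp only [LinearMap.add_apply, LinearMap.comp_apply, LinearMap.zero_apply]
  by_cases hi : i ∈ S
  · rw [kH_b, if_pos hi, kD_b]
    split_ifs
    · simp [kH_b, hi, hij]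
    · simp
  by_cases hj : j ∈ S
  · rw [kH_b, if_neg hi, kD_b, if_pos hj]
    simp only [map_smul, map_sub, map_neg, map_sum, kH_b, kD_b, Finset.mem_erase, Finset.mem_insert, hij,
      Ne.symm hij, hi, hj, and_false, false_or, or_true, if_true, if_false]
    have e1 : (c + eN j) i = c i := by simp [eN, hij]
    have e2 : ∀ t, c - (t+1) • eN i + eN j = c + eN j - (t+1) • eN i := by
      intro t; funext s
      by_cases hs : s = i
      · subst hs; simp [eN, hij]
      · simp [eN, hs]
    simp only [e1, e2, add_right_comm a (eN j)]
    rw [← Finset.smul_sum, smul_neg, smul_smul, Finset.sum_sub_distrib, ← Finset.erase_insert_of_ne hij,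
      ← smul_sub, smul_smul, ksgn_insert_erase i j S hij hi hj]
    module
  · simp [kD_b, kH_b, hi, hj, Ne.symm hij]

theorem kH_kD_self (i : Fin N) : kD b i ∘ₗ kH b i + kH b i ∘ₗ kD b i = LinearMap.id - kP b i := by
  refine b.ext ?_
  rintro ⟨a, S, c⟩
  simp only [LinearMap.add_apply, LinearMap.comp_apply, LinearMap.sub_apply, LinearMap.id_apply]
  by_cases hi : i ∈ S
  · rw [kH_b, if_pos hi, kD_b, if_pos hi, kP_b, if_pos hi]
    simp only [map_zero, zero_add, sub_zero, map_smul, map_sub, kH_b, Finset.mem_erase, ne_eq,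
      not_true_eq_false, false_and, if_false, Finset.insert_erase hi]
    rw [← smul_sub, smul_smul, ksgn_erase_self, ksgn_sq, one_smul]
    have e1 : (c + eN i) i = c i + 1 := by simp [eN]
    have e2 : ∀ t, c + eN i - (t+1) • eN i = c - t • eN i := by
      intro t; funext s
      by_cases hs : s = i
      · subst hs; simp [eN]
      · simp [eN, hs]
    rw [e1, Finset.sum_range_succ']
    simp only [e2]
    simp only [add_smul, one_smul, zero_smul, add_zero, tsub_zero, zero_add, ← add_assoc, add_right_comm a (eN i)]
    abel
  · rw [kH_b, if_neg hi, kD_b, if_neg hi, kP_b, if_neg hi]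
    simp only [map_zero, add_zero, map_smul, map_neg, map_sum, kD_b, Finset.mem_insert, true_or,
      if_true, Finset.erase_insert hi, ksgn_insert_self]
    rw [← Finset.smul_sum, ← smul_neg, smul_smul, ksgn_sq, one_smul]
    have : ∀ t ∈ Finset.range (c i), (b (a + t • eN i + eN i, S, c - (t+1) • eN i) -
        b (a + t • eN i, S, c - (t+1) • eN i + eN i)) =
        b (a + (t+1) • eN i, S, c - (t+1) • eN i) - b (a + t • eN i, S, c - t • eN i) := by
      intro t ht
      rw [Finset.mem_range] at ht
      congr 3
      · rw [add_smul, one_smul, add_assoc]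
      · refine Prod.ext rfl ?_
        funext s
        by_cases hs : s = i
        · subst hs; simp [eN]; omega
        · simp [eN, hs]
    rw [Finset.sum_congr rfl this,
      Finset.sum_range_sub (fun t => b (a + t • eN i, S, c - t • eN i))]
    simp

/-- `d` is the (untwisted) Koszul differential in the basis `b`. -/
def IsKoszul (d : V →ₗ[k] V) : Prop := ∀ a S c, d (b (a, S, c)) = ∑ j ∈ S, ksgn k j S •
    (b (a + eN j, S.erase j, c) - b (a, S.erase j, c + eN j))

variable (d : V →ₗ[k] V)

theorem d_eq_sum (hd : IsKoszul b d) : d = ∑ j, kD b j := by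
  refine b.ext ?_
  rintro ⟨a, S, c⟩
  rw [hd, LinearMap.sum_apply]
  simp only [kD_b]
  rw [Finset.sum_ite_mem, Finset.univ_inter]

theorem d_sq [CharZero k] (hd : IsKoszul b d) (x) : d (d x) = 0 := by
  have h : d ∘ₗ d + d ∘ₗ d = 0 := by
    rw [d_eq_sum b d hd]
    ext1 y
    simp only [LinearMap.add_apply, LinearMap.comp_apply, LinearMap.sum_apply, map_sum]
    nth_rw 1 [Finset.sum_comm]
    rw [← Finset.sum_add_distrib]
    refine Finset.sum_eq_zero fun i _ => ?_
    rw [← Finset.sum_add_distrib]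
    refine Finset.sum_eq_zero fun j _ => ?_
    first | exact LinearMap.congr_fun (kD_kD b i j) y | exact LinearMap.congr_fun (kD_kD b j i) y
  have h2 : (2 : k) • d (d x) = 0 := by
    rw [two_smul]; exact LinearMap.congr_fun h x
  simpa using h2

theorem d_H (hd : IsKoszul b d) (i : Fin N) (x) : d (kH b i x) + kH b i (d x) = x - kP b i x := by
  have h : d ∘ₗ kH b i + kH b i ∘ₗ d = LinearMap.id - kP b i := by
    rw [← kH_kD_self, d_eq_sum b d hd]
    ext1 y
    simp only [LinearMap.add_apply, LinearMap.comp_apply, LinearMap.sum_apply, map_sum]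
    rw [← Finset.sum_add_distrib, Finset.sum_eq_single i]
    · intro j _ hj
      exact LinearMap.congr_fun (kH_kD_ne b i j hj.symm) y
    · simp
  exact LinearMap.congr_fun h x

theorem d_P [CharZero k] (hd : IsKoszul b d) (i : Fin N) (x) : d (kP b i x) = kP b i (d x) := by
  have h1 := congrArg d (d_H b d hd i x)
  have h2 := d_H b d hd i (d x)
  rw [map_add, d_sq b d hd, zero_add, map_sub] at h1
  rw [d_sq b d hd, map_zero, add_zero, h1] at h2
  exact sub_right_injective h2

theorem homotopy_list [CharZero k] (hd : IsKoszul b d) (l : List (Fin N)) : ∃ H P : V →ₗ[k] V,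
    (∀ x, x = d (H x) + H (d x) + P x) ∧
    (∀ a S c, (∃ i ∈ l, i ∈ S) → P (b (a, S, c)) = 0) ∧
    (∀ a c, ∃ a' c', a' + c' = a + c ∧ c' ≤ c ∧ (∀ i ∈ l, c' i = 0) ∧
      P (b (a, ∅, c)) = b (a', ∅, c')) := by
  induction l with
  | nil =>
    refine ⟨0, LinearMap.id, fun x => by simp, by simp, fun a c => ⟨a, c, rfl, le_rfl, by simp, rfl⟩⟩
  | cons i l ih =>
    obtain ⟨H, P, h1, h2, h3⟩ := ih
    refine ⟨kH b i + H ∘ₗ kP b i, P ∘ₗ kP b i, ?_, ?_, ?_⟩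
    · intro x
      have e1 := d_H b d hd i x
      have e2 := h1 (kP b i x)
      rw [d_P b d hd] at e2
      simp only [LinearMap.add_apply, LinearMap.comp_apply, map_add]
      calc x = (x - kP b i x) + kP b i x := by abel
        _ = _ := by rw [← e1]; nth_rw 1 [e2]; abel
    · rintro a S c ⟨j, hj, hjS⟩
      rw [LinearMap.comp_apply, kP_b]
      split_ifs with hi
      · simp
      · apply h2
        rcases List.mem_cons.1 hj with rfl | hj
        · exact absurd hjS hi
        · exact ⟨j, hj, hjS⟩
    · intro a c
      rw [LinearMap.comp_apply, kP_b, if_neg (by simp)]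
      obtain ⟨a', c', e1, e2, e3, e4⟩ := h3 (a + c i • eN i) (c - c i • eN i)
      refine ⟨a', c', ?_, ?_, ?_, e4⟩
      · rw [e1]
        funext s
        by_cases hs : s = i
        · subst hs; simp [eN]
        · simp [eN, hs]
      · exact e2.trans (fun s => by simp)
      · intro j hj
        rcases List.mem_cons.1 hj with rfl | hj
        · have := e2 j
          simpa [eN] using this
        · exact e3 j hj

theorem homotopy_full [CharZero k] (hd : IsKoszul b d) {A : Type} [AddCommGroup A] [Module k A]
    (B : Module.Basis (Fin N → ℕ) k A) (ε : V →ₗ[k] A)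
    (hε0 : ∀ a c, ε (b (a, ∅, c)) = B (a + c)) (hε1 : ∀ a S c, S.Nonempty → ε (b (a, S, c)) = 0) :
    ∃ (H : V →ₗ[k] V) (s : A →ₗ[k] V), ∀ x, x = d (H x) + H (d x) + s (ε x) := by
  obtain ⟨H, P, h1, h2, h3⟩ := homotopy_list b d hd (List.finRange N)
  refine ⟨H, B.constr k (fun a => b (a, ∅, 0)), ?_⟩
  intro x
  have : P = (B.constr k (fun a => b (a, ∅, 0))) ∘ₗ ε := by
    refine b.ext ?_
    rintro ⟨a, S, c⟩
    rw [LinearMap.comp_apply]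
    rcases S.eq_empty_or_nonempty with rfl | hS
    · obtain ⟨a', c', e1, e2, e3, e4⟩ := h3 a c
      have hc : c' = 0 := funext fun i => e3 i (List.mem_finRange i)
      subst hc
      rw [e4, hε0, Module.Basis.constr_basis, ← e1, add_zero]
    · rw [hε1 a S c hS, map_zero]
      obtain ⟨i, hi⟩ := hS
      exact h2 _ _ _ ⟨i, List.mem_finRange i, hi⟩
  have h := h1 x
  rw [this] at h
  exact h
end koszul

section cochain
variable {k : Type} [Field k] {N : ℕ}

/-- the internal degree of `x^α ⊗ (x^*)^S` -/
def gam (α : Fin N → ℕ) (S : Finset (Fin N)) : Fin N → ℤ := cN α - betaZ N S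

theorem gam_insert (α : Fin N → ℕ) (S : Finset (Fin N)) (i) (hi : i ∉ S) :
    gam (α + eN i) (insert i S) = gam α S := by
  funext s
  by_cases hs : s = i
  · subst hs; simp [gam, cN, eN, betaZ, hi]
  · simp [gam, cN, eN, betaZ, hs]

theorem gam_erase (α : Fin N → ℕ) (S : Finset (Fin N)) (i) (hi : i ∈ S) (hg : gam α S i ≠ -1) :
    α - eN i + eN i = α ∧ gam (α - eN i) (S.erase i) = gam α S := by
  have h : α - eN i + eN i = α := by
    funext s
    by_cases hs : s = i
    · subst hs
      have : α s ≠ 0 := by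
        intro h0; apply hg; simp [gam, cN, betaZ, hi, h0]
      simp [eN]; omega
    · simp [eN, hs]
  refine ⟨h, ?_⟩
  rw [← gam_insert _ _ i (by simp), Finset.insert_erase hi, h]

variable {W : Type} [AddCommGroup W] [Module k W]
  (t : Module.Basis ((Fin N → ℕ) × Finset (Fin N)) k W) (w : Fin N → (Fin N → ℤ) → k)

def cD (j : Fin N) : W →ₗ[k] W := t.constr k (fun x =>
  if j ∈ x.2 then 0 else (ksgn k j x.2 * w j (gam x.1 x.2)) • t (x.1 + eN j, insert j x.2))

def cH (i : Fin N) : W →ₗ[k] W := t.constr k (fun x =>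
  if i ∈ x.2 then (ksgn k i x.2 * (w i (gam x.1 x.2))⁻¹) • t (x.1 - eN i, x.2.erase i) else 0)

theorem cD_t (j α S) : cD t w j (t (α, S)) = if j ∈ S then 0 else
    (ksgn k j S * w j (gam α S)) • t (α + eN j, insert j S) := by
  rw [cD, Module.Basis.constr_basis]

theorem cH_t (i α S) : cH t w i (t (α, S)) = if i ∈ S then
    (ksgn k i S * (w i (gam α S))⁻¹) • t (α - eN i, S.erase i) else 0 := by
  rw [cH, Module.Basis.constr_basis]

theorem cH_cD_self (i α S) (hg : gam α S i ≠ -1) (hw : w i (gam α S) ≠ 0) :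
    cD t w i (cH t w i (t (α, S))) + cH t w i (cD t w i (t (α, S))) = t (α, S) := by
  by_cases hi : i ∈ S
  · obtain ⟨h1, h2⟩ := gam_erase α S i hi hg
    rw [cH_t, if_pos hi, cD_t, if_pos hi, map_zero, add_zero, map_smul, cD_t, if_neg (by simp), h1, h2,
      Finset.insert_erase hi, smul_smul, ksgn_erase_self]
    have := ksgn_sq (k := k) i S
    rw [show ksgn k i S * (w i (gam α S))⁻¹ * (ksgn k i S * w i (gam α S)) =
      (ksgn k i S * ksgn k i S) * ((w i (gam α S))⁻¹ * w i (gam α S)) by ring, this,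
      inv_mul_cancel₀ hw, one_mul, one_smul]
  · rw [cH_t, if_neg hi, cD_t, if_neg hi, map_zero, zero_add, map_smul, cH_t, if_pos (by simp),
      gam_insert _ _ _ hi, Finset.erase_insert hi, smul_smul, ksgn_insert_self]
    have := ksgn_sq (k := k) i S
    rw [show ksgn k i S * w i (gam α S) * (ksgn k i S * (w i (gam α S))⁻¹) =
      (ksgn k i S * ksgn k i S) * (w i (gam α S) * (w i (gam α S))⁻¹) by ring, this,
      mul_inv_cancel₀ hw, one_mul, one_smul]
    simp

theorem cH_cD_ne (i j α S) (hij : j ≠ i) (hg : gam α S i ≠ -1) :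
    cD t w j (cH t w i (t (α, S))) + cH t w i (cD t w j (t (α, S))) = 0 := by
  by_cases hi : i ∈ S
  · obtain ⟨h1, h2⟩ := gam_erase α S i hi hg
    by_cases hj : j ∈ S
    · simp [cH_t, cD_t, hi, hj, hij]
    · rw [cH_t, if_pos hi, cD_t, if_neg hj, map_smul, map_smul, cD_t, if_neg (by simp [hj]), cH_t,
        if_pos (by simp [hi]), gam_insert _ _ _ hj, h2, smul_smul, smul_smul,
        Finset.erase_insert_of_ne hij]
      have e2 : α + eN j - eN i = α - eN i + eN j := by
        funext s
        by_cases hs : s = i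
        · subst hs; simp [eN, hij]
        · simp [eN, hs]
      rw [e2, ← add_smul]
      have := ksgn_insert_erase (k := k) j i S hij hj hi
      rw [show ksgn k i S * (w i (gam α S))⁻¹ * (ksgn k j (S.erase i) * w j (gam α S)) +
        ksgn k j S * w j (gam α S) * (ksgn k i (insert j S) * (w i (gam α S))⁻¹) =
        (ksgn k i S * ksgn k j (S.erase i) + ksgn k j S * ksgn k i (insert j S)) *
          ((w i (gam α S))⁻¹ * w j (gam α S)) by ring, this]
      simp
  · by_cases hj : j ∈ S
    · simp [cH_t, cD_t, hi, hj]
    · simp [cH_t, cD_t, hi, hj, Ne.symm hij]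

/-- `δ` is the cochain differential with weights `w` -/
def IsCoKoszul (δ : W →ₗ[k] W) : Prop := δ = ∑ j, cD t w j

def cSet : Set (Fin N → ℤ) := {γ | ∀ i, w i γ = 0 ∨ γ i = -1}

def cPi : W →ₗ[k] W := t.constr k (fun x => if gam x.1 x.2 ∈ cSet w then t x else 0)

theorem cPi_t (α S) : cPi t w (t (α, S)) = if gam α S ∈ cSet w then t (α, S) else 0 := by
  rw [cPi, Module.Basis.constr_basis]

theorem delta_t_zero (δ : W →ₗ[k] W) (hδ : IsCoKoszul t w δ) (α S) (h : gam α S ∈ cSet w) :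
    δ (t (α, S)) = 0 := by
  rw [hδ, LinearMap.sum_apply]
  refine Finset.sum_eq_zero fun j _ => ?_
  rw [cD_t]
  split_ifs with hj
  · rfl
  · rcases h j with h | h
    · rw [h]; simp
    · simp only [gam, cN, betaZ, Pi.sub_apply, if_neg hj] at h
      omega

theorem cPi_delta (δ : W →ₗ[k] W) (hδ : IsCoKoszul t w δ) (x) : cPi t w (δ x) = 0 := by
  have : cPi t w ∘ₗ δ = 0 := by
    refine t.ext ?_
    rintro ⟨α, S⟩
    rw [LinearMap.comp_apply]
    by_cases h : gam α S ∈ cSet w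
    · rw [delta_t_zero t w δ hδ _ _ h]; simp
    · rw [hδ, LinearMap.sum_apply, map_sum]
      refine Finset.sum_eq_zero fun j _ => ?_
      rw [cD_t]
      split_ifs with hj
      · simp
      · rw [map_smul, cPi_t, gam_insert _ _ _ hj, if_neg h, smul_zero]
  exact LinearMap.congr_fun this x

theorem co_homotopy (δ : W →ₗ[k] W) (hδ : IsCoKoszul t w δ) : ∃ η : W →ₗ[k] W,
    ∀ x, x = δ (η x) + η (δ x) + cPi t w x := by
  have hC : ∀ γ : Fin N → ℤ, γ ∉ cSet w → ∃ i, w i γ ≠ 0 ∧ γ i ≠ -1 := by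
    intro γ h
    simpa [cSet] using h
  choose pk hpk1 hpk2 using hC
  let η : W →ₗ[k] W := t.constr k (fun x => if h : gam x.1 x.2 ∈ cSet w then 0 else
    cH t w (pk _ h) (t x))
  have hη : ∀ α S, η (t (α, S)) = if h : gam α S ∈ cSet w then 0 else
      cH t w (pk _ h) (t (α, S)) := by
    intro α S
    simp only [η]
    rw [Module.Basis.constr_basis]
  refine ⟨η, ?_⟩
  suffices h : LinearMap.id = δ ∘ₗ η + η ∘ₗ δ + cPi t w from fun x => LinearMap.congr_fun h x
  refine t.ext ?_
  rintro ⟨α, S⟩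
  simp only [LinearMap.add_apply, LinearMap.comp_apply, LinearMap.id_apply]
  by_cases h : gam α S ∈ cSet w
  · rw [delta_t_zero t w δ hδ _ _ h, hη, dif_pos h, cPi_t, if_pos h]; simp
  · rw [cPi_t, if_neg h, hη, dif_neg h, add_zero, hδ, LinearMap.sum_apply, LinearMap.sum_apply, map_sum,
      ← Finset.sum_add_distrib]
    have key : ∀ j, η (cD t w j (t (α, S))) = cH t w (pk _ h) (cD t w j (t (α, S))) := by
      intro j
      rw [cD_t]
      split_ifs with hj
      · simp
      · rw [map_smul, map_smul, hη, dif_neg (by rw [gam_insert _ _ _ hj]; exact h)]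
        congr 4
        all_goals simp only [gam_insert _ _ _ hj]
    simp only [key]
    rw [Finset.sum_eq_single (pk _ h), cH_cD_self t w _ _ _ (hpk2 _ h) (hpk1 _ h)]
    · intro j _ hj
      exact cH_cD_ne t w _ _ _ _ hj (hpk2 _ h)
    · simp

theorem cPi_repr (x α S) : t.repr (cPi t w x) (α, S) =
    if gam α S ∈ cSet w then t.repr x (α, S) else 0 := by
  have : (Finsupp.lapply (α, S)) ∘ₗ t.repr.toLinearMap ∘ₗ cPi t w =
      if gam α S ∈ cSet w then (Finsupp.lapply (α, S)) ∘ₗ t.repr.toLinearMap else 0 := by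
    refine t.ext ?_
    rintro ⟨α', S'⟩
    simp only [LinearMap.comp_apply, cPi_t]
    by_cases he : (α', S') = (α, S)
    · obtain ⟨rfl, rfl⟩ := Prod.mk.inj he
      split_ifs <;> simp
    · split_ifs <;> simp [he]
  have h := LinearMap.congr_fun this x
  split_ifs at h ⊢ <;> exact h
end cochain

section absE
variable {k R A : Type} [Field k] [Ring R] [Algebra k R] [AddCommGroup A] [Module k A] [Module R A]
  [IsScalarTower k R A] {N : ℕ}

abbrev iota (N p : ℕ) : Type := {S : Finset (Fin N) // S.card = p}

variable (R) in
def incE (p : ℕ) : (iota N p →₀ R) →ₗ[R] (Finset (Fin N) →₀ R) :=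
  Finsupp.linearCombination R (fun S => Finsupp.single S.1 1)

variable (R) in
def rhoE (p : ℕ) : (Finset (Fin N) →₀ R) →ₗ[R] (iota N p →₀ R) :=
  Finsupp.linearCombination R (fun S => if h : S.card = p then Finsupp.single ⟨S, h⟩ 1 else 0)

theorem incE_single (p : ℕ) (S : iota N p) (r : R) :
    incE R p (Finsupp.single S r) = Finsupp.single S.1 r := by
  simp [incE]

theorem rhoE_pos (p : ℕ) (S : Finset (Fin N)) (h : S.card = p) (r : R) :
    rhoE R p (Finsupp.single S r) = Finsupp.single ⟨S, h⟩ r := by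
  simp [rhoE, h]

theorem rhoE_neg (p : ℕ) (S : Finset (Fin N)) (h : S.card ≠ p) (r : R) :
    rhoE R p (Finsupp.single S r) = 0 := by
  simp [rhoE, h]

theorem rho_inc (p : ℕ) (x : iota N p →₀ R) : rhoE R p (incE R p x) = x := by
  induction x using Finsupp.induction_linear with
  | zero => simp
  | add f g hf hg => rw [map_add, map_add, hf, hg]
  | single S r => rw [incE_single, rhoE_pos p S.1 S.2]

variable (z : Fin N → Finset (Fin N) → R)

variable (k) in
def dT : (Finset (Fin N) →₀ R) →ₗ[R] (Finset (Fin N) →₀ R) :=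
  Finsupp.linearCombination R
    (fun S => ∑ i ∈ S, Finsupp.single (S.erase i) (ksgn k i S • z i S))

theorem dT_single (S : Finset (Fin N)) (r : R) : dT k z (Finsupp.single S r) =
    ∑ i ∈ S, Finsupp.single (S.erase i) (r * (ksgn k i S • z i S)) := by
  simp [dT, Finset.smul_sum]

variable (k) in
def dE (p : ℕ) : (iota N (p+1) →₀ R) →ₗ[R] (iota N p →₀ R) :=
  rhoE R p ∘ₗ dT k z ∘ₗ incE R (p+1)

theorem card_er (S : Finset (Fin N)) (p : ℕ) (i) (hi : i ∈ S) :
    (S.erase i).card = p ↔ S.card = p + 1 := by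
  rw [← Finset.card_erase_add_one hi]; omega

theorem inc_dE (p : ℕ) (x : iota N (p+1) →₀ R) :
    incE R p (dE k z p x) = dT k z (incE R (p+1) x) := by
  induction x using Finsupp.induction_linear with
  | zero => simp
  | add f g hf hg => rw [map_add, map_add, hf, hg, map_add, map_add]
  | single S r =>
    simp only [dE, LinearMap.comp_apply, incE_single, dT_single, map_sum]
    refine Finset.sum_congr rfl fun i hi => ?_
    rw [rhoE_pos p _ ((card_er _ _ _ hi).2 S.2), incE_single]

theorem rho_dT (p : ℕ) (y : Finset (Fin N) →₀ R) :
    rhoE R p (dT k z y) = dE k z p (rhoE R (p+1) y) := by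
  induction y using Finsupp.induction_linear with
  | zero => simp
  | add f g hf hg => rw [map_add, map_add, hf, hg, map_add, map_add]
  | single S r =>
    by_cases h : S.card = p + 1
    · rw [rhoE_pos (p+1) S h]
      simp only [dE, LinearMap.comp_apply, incE_single]
    · rw [rhoE_neg (p+1) S h, map_zero, dT_single, map_sum]
      refine Finset.sum_eq_zero fun i hi => ?_
      rw [rhoE_neg]
      rwa [ne_eq, card_er _ _ _ hi]

/-- cochain differential -/
def delE (k : Type) [Field k] [Algebra k R] [Module k A] [IsScalarTower k R A]
    (z : Fin N → Finset (Fin N) → R) : (Finset (Fin N) → A) →ₗ[k] (Finset (Fin N) → A) where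
  toFun u S := ∑ i ∈ S, (ksgn k i S • z i S) • u (S.erase i)
  map_add' u v := by
    funext S; simp [Finset.sum_add_distrib]
  map_smul' c u := by
    have : SMulCommClass k R A := IsScalarTower.to_smulCommClass
    funext S
    simp only [Pi.smul_apply, RingHom.id_apply, Finset.smul_sum]
    refine Finset.sum_congr rfl fun i _ => ?_
    rw [smul_comm]

theorem delE_apply (u : Finset (Fin N) → A) (S) :
    delE k z u S = ∑ i ∈ S, (ksgn k i S • z i S) • u (S.erase i) := rfl

def uf (m : ℕ) (f : (iota N m →₀ R) →ₗ[R] A) : Finset (Fin N) → A :=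
  fun S => if h : S.card = m then f (Finsupp.single ⟨S, h⟩ 1) else 0

variable (k) (A) (N) in
def prE (m : ℕ) : (Finset (Fin N) → A) →ₗ[k] (Finset (Fin N) → A) where
  toFun u S := if S.card = m then u S else 0
  map_add' u v := by funext S; simp only [Pi.add_apply]; split_ifs <;> simp
  map_smul' c u := by funext S; simp only [Pi.smul_apply, RingHom.id_apply]; split_ifs <;> simp

theorem prE_apply (m : ℕ) (u : Finset (Fin N) → A) (S) :
    prE k A N m u S = if S.card = m then u S else 0 := rfl

theorem uf_comp (m : ℕ) (f : (iota N m →₀ R) →ₗ[R] A) :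
    uf (m+1) (f ∘ₗ dE k z m) = delE k z (uf m f) := by
  funext S
  rw [delE_apply]
  by_cases h : S.card = m + 1
  · rw [uf, dif_pos h]
    simp only [dE, LinearMap.comp_apply, incE_single, dT_single, map_sum]
    refine Finset.sum_congr rfl fun i hi => ?_
    have h' := (card_er _ _ _ hi).2 h
    rw [rhoE_pos m _ h', uf, dif_pos h', ← map_smul, one_mul]
    simp
  · rw [uf, dif_neg h]
    symm
    refine Finset.sum_eq_zero fun i hi => ?_
    rw [uf, dif_neg (by rwa [card_er _ _ _ hi]), smul_zero]

theorem pr_del (m : ℕ) (u : Finset (Fin N) → A) :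
    prE k A N (m+1) (delE k z u) = delE k z (prE k A N m u) := by
  funext S
  rw [delE_apply, prE_apply]
  split_ifs with h
  · rw [delE_apply]
    refine Finset.sum_congr rfl fun i hi => ?_
    rw [prE_apply, if_pos ((card_er _ _ _ hi).2 h)]
  · symm
    refine Finset.sum_eq_zero fun i hi => ?_
    rw [prE_apply, if_neg (by rwa [card_er _ _ _ hi]), smul_zero]

theorem pr_del_zero (u : Finset (Fin N) → A) : prE k A N 0 (delE k z u) = 0 := by
  funext S
  rw [prE_apply, delE_apply]
  split_ifs with h
  · rw [Finset.card_eq_zero] at h; subst h; simp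
  · rfl

theorem uf_surj (m : ℕ) (u : Finset (Fin N) → A) :
    ∃ g : (iota N m →₀ R) →ₗ[R] A, uf m g = prE k A N m u := by
  refine ⟨Finsupp.linearCombination R (fun S => u S.1), ?_⟩
  funext S
  rw [uf, prE_apply]
  split_ifs <;> simp

theorem uf_inj (m : ℕ) (f g : (iota N m →₀ R) →ₗ[R] A) (h : uf m f = uf m g) : f = g := by
  refine Finsupp.lhom_ext' fun S => LinearMap.ext_ring ?_
  have := congrFun h S.1
  simpa [uf, S.2] using this

theorem pr_uf (m : ℕ) (f : (iota N m →₀ R) →ₗ[R] A) : prE k A N m (uf m f) = uf m f := by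
  funext S
  rw [prE_apply, uf]
  split_ifs <;> simp

theorem pr_repr (t : Module.Basis ((Fin N → ℕ) × Finset (Fin N)) k (Finset (Fin N) → A))
    (ht : ∀ α S T, T ≠ S → t (α, S) T = 0) (m : ℕ) (α S) (hS : S.card ≠ m) (u) :
    t.repr (prE k A N m u) (α, S) = 0 := by
  have key : ∀ α S, prE k A N m (t (α, S)) = if S.card = m then t (α, S) else 0 := by
    intro α S
    funext T
    rw [prE_apply]
    by_cases hT : T = S
    · subst hT; split_ifs <;> rfl
    · rw [ht α S T hT]; split_ifs
      · rw [ht α S T hT]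
      · rfl
      · rw [ht α S T hT]
      · rfl
  have : (Finsupp.lapply (α, S) ∘ₗ t.repr.toLinearMap ∘ₗ prE k A N m : _ →ₗ[k] k) = 0 := by
    refine t.ext fun ⟨α', S'⟩ => ?_
    simp only [LinearMap.comp_apply, key, LinearMap.zero_apply]
    split_ifs with h
    · simp
      rw [Finsupp.single_apply, if_neg]
      rintro h2
      apply hS
      rw [← h, (Prod.mk.inj h2).2]
    · simp
  exact LinearMap.congr_fun this u

theorem abs_main [CharZero k]
    (bK : Module.Basis ((Fin N → ℕ) × Finset (Fin N) × (Fin N → ℕ)) k (Finset (Fin N) →₀ R))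
    (hK : IsKoszul bK ((dT k z).restrictScalars k))
    (B : Module.Basis (Fin N → ℕ) k A) (εT : (Finset (Fin N) →₀ R) →ₗ[R] A)
    (hε0 : ∀ a c, εT (bK (a, ∅, c)) = B (a + c))
    (hε1 : ∀ S r, S.Nonempty → εT (Finsupp.single S r) = 0)
    (hε2 : ∀ a S c, S.Nonempty → εT (bK (a, S, c)) = 0)
    (t : Module.Basis ((Fin N → ℕ) × Finset (Fin N)) k (Finset (Fin N) → A))
    (ht : ∀ α S T, T ≠ S → t (α, S) T = 0) (w : Fin N → (Fin N → ℤ) → k)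
    (hδ : IsCoKoszul t w (delE k z)) (m : ℕ) :
    Nonempty (((Ext k (ModuleCat.{0} R) m).obj
        (Opposite.op (ModuleCat.of R A))).obj (ModuleCat.of R A) ≃ₗ[k]
      ({p : (Fin N → ℕ) × Finset (Fin N) // p.2.card = m ∧ gam p.1 p.2 ∈ cSet w} →₀ k)) := by
  have hdd : ∀ x, dT k z (dT k z x) = 0 := fun x => d_sq bK _ hK x
  have hεd : ∀ x, εT (dT k z x) = 0 := by
    have : (εT.restrictScalars k) ∘ₗ ((dT k z).restrictScalars k) = 0 := by
      refine bK.ext fun ⟨a, S, c⟩ => ?_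
      rw [LinearMap.comp_apply, hK, map_sum, LinearMap.zero_apply]
      refine Finset.sum_eq_zero fun j hj => ?_
      rw [map_smul, map_sub, LinearMap.restrictScalars_apply, LinearMap.restrictScalars_apply]
      by_cases h : (S.erase j) = ∅
      · rw [h, hε0, hε0, add_right_comm, add_assoc, sub_self, smul_zero]
      · rw [hε2 _ _ _ (Finset.nonempty_iff_ne_empty.2 h), hε2 _ _ _ (Finset.nonempty_iff_ne_empty.2 h),
          sub_self, smul_zero]
    exact fun x => LinearMap.congr_fun this x
  obtain ⟨H, s, hH⟩ := homotopy_full bK _ hK B (εT.restrictScalars k) hε0 hε2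
  simp only [LinearMap.restrictScalars_apply] at hH
  have hεinc : ∀ p x, εT (incE R (p+1) x) = 0 := by
    intro p x
    induction x using Finsupp.induction_linear with
    | zero => simp
    | add f g hf hg => rw [map_add, map_add, hf, hg, add_zero]
    | single S r =>
      rw [incE_single, hε1]
      rw [← Finset.card_pos, S.2]; omega
  have hdinc : ∀ x, dT k z (incE R 0 x) = 0 := by
    intro x
    induction x using Finsupp.induction_linear with
    | zero => simp
    | add f g hf hg => rw [map_add, map_add, hf, hg, add_zero]
    | single S r =>
      rw [incE_single, Finset.card_eq_zero.1 S.2, dT_single, Finset.sum_empty]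
  have hεrho : ∀ y, εT (incE R 0 (rhoE R 0 y)) = εT y := by
    intro x
    induction x using Finsupp.induction_linear with
    | zero => simp
    | add f g hf hg => rw [map_add, map_add, map_add, hf, hg, map_add]
    | single S r =>
      by_cases h : S.card = 0
      · rw [rhoE_pos 0 S h, incE_single]
      · rw [rhoE_neg 0 S h, map_zero, map_zero, hε1]
        rw [← Finset.card_pos]; omega
  have hεsurj : Function.Surjective εT := by
    intro a
    have h : (εT.restrictScalars k) ∘ₗ (B.constr k (fun a => bK (a, ∅, 0))) = LinearMap.id := by
      refine B.ext fun a => ?_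
      rw [LinearMap.comp_apply, Module.Basis.constr_basis, LinearMap.restrictScalars_apply, hε0, add_zero,
        LinearMap.id_apply]
    exact ⟨_, LinearMap.congr_fun h a⟩
  obtain ⟨η, hη⟩ := co_homotopy t w _ hδ
  let P : (Fin N → ℕ) × Finset (Fin N) → Prop := fun p => p.2.card = m ∧ gam p.1 p.2 ∈ cSet w
  have hpi : ∀ f : (iota N m →₀ R) →ₗ[R] A, Finsupp.subtypeDomain P (t.repr (uf m f)) = 0 →
      f.comp (dE k z m) = 0 → uf m f = delE k z (η (uf m f)) := by
    intro f hf hf2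
    have h1 : delE k z (uf m f) = 0 := by
      rw [← uf_comp, hf2]; funext S; simp [uf]
    have h2 : cPi t w (uf m f) = 0 := by
      apply t.repr.injective
      ext ⟨α, S⟩
      rw [cPi_repr, map_zero, Finsupp.zero_apply]
      split_ifs with h
      · by_cases hS : S.card = m
        · have := DFunLike.congr_fun hf ⟨(α, S), hS, h⟩
          simpa using this
        · rw [← pr_uf (k := k)]
          exact pr_repr t ht m α S hS _
      · rfl
    have := hη (uf m f)
    rwa [h1, h2, map_zero, add_zero, add_zero] at this
  refine ext_compute A A (iota N) (dE k z) (εT ∘ₗ incE R 0) ?_ ?_ ?_ ?_ ?_ m _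
    (fun f => Finsupp.subtypeDomain P (t.repr (uf m f))) ?_ ?_ ?_ ?_ ?_ ?_
  · intro p x
    change rhoE R p (dT k z (incE R (p+1) _)) = 0
    rw [inc_dE, hdd, map_zero]
  · intro x
    rw [LinearMap.comp_apply, inc_dE, hεd]
  · intro a
    obtain ⟨y, rfl⟩ := hεsurj a
    exact ⟨rhoE R 0 y, hεrho y⟩
  · intro x hx
    refine ⟨rhoE R 1 (H (incE R 0 x)), ?_⟩
    rw [← rho_dT]
    have := hH (incE R 0 x)
    rw [LinearMap.comp_apply] at hx
    rw [hdinc, hx, map_zero, map_zero, add_zero, add_zero] at this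
    rw [← this, rho_inc]
  · intro p x hx
    refine ⟨rhoE R (p+1+1) (H (incE R (p+1) x)), ?_⟩
    rw [← rho_dT]
    have := hH (incE R (p+1) x)
    rw [← inc_dE, hx, hεinc, map_zero, map_zero, map_zero, add_zero, add_zero] at this
    rw [← this, rho_inc]
  · intro f g
    have : uf m (f + g) = uf m f + uf m g := by
      funext S; simp only [uf, Pi.add_apply]; split_ifs <;> simp
    simp only [this, map_add, Finsupp.subtypeDomain_add]
  · intro c f g hfg
    have : uf m g = c • uf m f := by
      funext S; simp only [uf, Pi.smul_apply]; split_ifs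
      · rw [hfg, algebraMap_smul]
      · simp
    simp only [this, map_smul]
    ext p
    simp
  · intro n h f
    subst h
    ext ⟨⟨α, S⟩, hp⟩
    change t.repr (uf (n+1) (f ∘ₗ dE k z n)) (α, S) = 0
    have h1 := cPi_repr t w (delE k z (uf n f)) α S
    rw [cPi_delta t w _ hδ, if_pos hp.2, ← uf_comp] at h1
    rw [← h1]; simp
  · intro v
    let u : Finset (Fin N) → A := Finsupp.linearCombination k (fun p : {p // P p} => t p.1) v
    have hu1 : prE k A N m u = u := by
      have : prE k A N m ∘ₗ (Finsupp.linearCombination k (fun p : {p // P p} => t p.1)) =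
          Finsupp.linearCombination k (fun p : {p // P p} => t p.1) := by
        refine Finsupp.lhom_ext' fun p => LinearMap.ext_ring ?_
        simp only [LinearMap.comp_apply, Finsupp.lsingle_apply, Finsupp.linearCombination_single, one_smul]
        funext T
        rw [prE_apply]
        split_ifs with h
        · rfl
        · symm
          obtain ⟨⟨α, S⟩, hp⟩ := p
          apply ht
          rintro rfl
          exact h hp.1
      exact LinearMap.congr_fun this v
    have hu2 : delE k z u = 0 := by
      have : delE k z ∘ₗ (Finsupp.linearCombination k (fun p : {p // P p} => t p.1)) = 0 := by
        refine Finsupp.lhom_ext' fun p => LinearMap.ext_ring ?_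
        simp only [LinearMap.comp_apply, Finsupp.lsingle_apply, Finsupp.linearCombination_single, one_smul]
        obtain ⟨⟨α, S⟩, hp⟩ := p
        exact delta_t_zero t w _ hδ α S hp.2
      exact LinearMap.congr_fun this v
    obtain ⟨f, hf⟩ := uf_surj (k := k) (R := R) m u
    refine ⟨f, ?_, ?_⟩
    · apply uf_inj
      change uf (m+1) (f ∘ₗ dE k z m) = _
      rw [uf_comp, hf, hu1, hu2]
      funext S; simp [uf]
    · simp only [hf, hu1]
      have : Finsupp.lsubtypeDomain {p | P p} ∘ₗ t.repr.toLinearMap ∘ₗ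
          (Finsupp.linearCombination k (fun p : {p // P p} => t p.1)) = (LinearMap.id : _ →ₗ[k] ({p // P p} →₀ k)) := by
        refine Finsupp.lhom_ext' fun p => LinearMap.ext_ring ?_
        simp only [LinearMap.comp_apply, Finsupp.lsingle_apply, Finsupp.linearCombination_single, one_smul]
        ext p'
        change t.repr (t p.1) p'.1 = Finsupp.single p (1 : k) p'
        rw [Module.Basis.repr_self, Finsupp.single_apply, Finsupp.single_apply]
        simp only [Subtype.ext_iff]
      exact LinearMap.congr_fun this v
  · intro hm f hf hf2
    have h1 := hpi f hf2 hf
    subst hm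
    apply uf_inj
    rw [← pr_uf (k := k) 0 f, h1, pr_del_zero]
    funext S; simp [uf]
  · intro n h f hf hf2
    have h1 := hpi f hf2 hf
    subst h
    obtain ⟨g, hg⟩ := uf_surj (k := k) (R := R) n (η (uf (n+1) f))
    refine ⟨g, ?_⟩
    apply uf_inj
    change uf (n+1) (g ∘ₗ dE k z n) = _
    rw [uf_comp, hg, ← pr_del, ← h1, pr_uf]

end absE

section genF
variable {k : Type} [Field k] {N : ℕ} (q : Fin N → Fin N → k)
variable {A : Type} [Ring A] [Algebra k A]

abbrev aeMod (k A : Type) [Field k] [Ring A] [Algebra k A] : Module (A ⊗[k] Aᵐᵒᵖ) A :=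
  TensorProduct.Algebra.module

attribute [local instance] aeMod

theorem ae_smul (a c x : A) : (a ⊗ₜ[k] MulOpposite.op c : A ⊗[k] Aᵐᵒᵖ) • x = a * (x * c) := by
  rw [TensorProduct.Algebra.smul_def]; rfl

theorem ae_tower : IsScalarTower k (A ⊗[k] Aᵐᵒᵖ) A := by
  refine ⟨fun c r x => ?_⟩
  induction r using TensorProduct.induction_on with
  | zero =>
    have h0 : (0 : A ⊗[k] Aᵐᵒᵖ) • x = 0 := (aeMod k A).zero_smul x
    rw [smul_zero]
    exact h0.trans ((congrArg (c • ·) h0).trans (smul_zero c)).symm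
  | add r s hr hs => rw [smul_add, add_smul, add_smul, smul_add, hr, hs]
  | tmul a b =>
    obtain ⟨b, rfl⟩ := MulOpposite.op_surjective b
    rw [TensorProduct.smul_tmul', ae_smul, ae_smul, smul_mul_assoc]

theorem betaZ_erase (S : Finset (Fin N)) (i) (hi : i ∈ S) :
    betaZ N S = betaZ N (S.erase i) + cN (eN i) := by
  funext s
  by_cases hs : s = i
  · subst hs; simp [betaZ, cN, eN, hi]
  · simp [betaZ, cN, eN, hs]

theorem betaZ_empty : betaZ N ∅ = 0 := by
  funext s; simp [betaZ]

variable (B : Module.Basis (Fin N → ℕ) k A)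

def zF (i : Fin N) (S : Finset (Fin N)) : A ⊗[k] Aᵐᵒᵖ :=
  (sg q (cN (eN i)) (betaZ N (S.erase i)))⁻¹ • (B (eN i) ⊗ₜ[k] MulOpposite.op 1) -
  (sg q (betaZ N (S.erase i)) (cN (eN i)))⁻¹ • (1 ⊗ₜ[k] MulOpposite.op (B (eN i)))

def kap (x : (Fin N → ℕ) × Finset (Fin N) × (Fin N → ℕ)) : k :=
  (sg q (cN x.1) (betaZ N x.2.1) * sg q (cN x.1) (cN x.2.2) * sg q (betaZ N x.2.1) (cN x.2.2))⁻¹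

theorem kap_unit (hq0 : ∀ i j, q i j ≠ 0) (x) : IsUnit (kap q x) := by
  rw [isUnit_iff_ne_zero, kap]
  simp [sg_ne q hq0]

def idxE (N : ℕ) : (Σ _ : Finset (Fin N), (Fin N → ℕ) × (Fin N → ℕ)) ≃
    (Fin N → ℕ) × Finset (Fin N) × (Fin N → ℕ) where
  toFun x := (x.2.1, x.1, x.2.2)
  invFun y := ⟨y.2.1, y.1, y.2.2⟩
  left_inv _ := rfl
  right_inv _ := rfl

def bF (hq0 : ∀ i j, q i j ≠ 0) :
    Module.Basis ((Fin N → ℕ) × Finset (Fin N) × (Fin N → ℕ)) k (Finset (Fin N) →₀ (A ⊗[k] Aᵐᵒᵖ)) :=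
  ((Finsupp.basis (fun _ : Finset (Fin N) => B.tensorProduct B.mulOpposite)).reindex
    (idxE N)).isUnitSMul (kap_unit q hq0)

theorem bF_apply (hq0 : ∀ i j, q i j ≠ 0) (a S c) : bF q B hq0 (a, S, c) =
    Finsupp.single S (kap q (a, S, c) • (B a ⊗ₜ[k] MulOpposite.op (B c))) := by
  rw [bF, Module.Basis.isUnitSMul_apply, Module.Basis.reindex_apply, Finsupp.coe_basis,
    ← Finsupp.smul_single]
  change _ • Finsupp.single S ((B.tensorProduct B.mulOpposite) (a, c)) = _
  rw [Module.Basis.tensorProduct_apply, Module.Basis.mulOpposite_apply]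

theorem bF_koszul (hq0 : ∀ i j, q i j ≠ 0)
    (hB : ∀ a b, B a * B b = sg q (cN a) (cN b) • B (a + b)) :
    IsKoszul (k := k) (V := Finset (Fin N) →₀ (A ⊗[k] Aᵐᵒᵖ)) (bF q B hq0)
      ((dT k (zF q B)).restrictScalars k) := by
  intro a S c
  rw [LinearMap.restrictScalars_apply, bF_apply, dT_single]
  refine Finset.sum_congr rfl fun i hi => ?_
  rw [bF_apply, bF_apply, ← Finsupp.single_sub, Finsupp.smul_single]
  congr 1
  rw [mul_smul_comm]
  congr 1
  rw [zF, mul_sub, smul_mul_smul_comm, smul_mul_smul_comm, Algebra.TensorProduct.tmul_mul_tmul,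
    Algebra.TensorProduct.tmul_mul_tmul, ← MulOpposite.op_mul, ← MulOpposite.op_mul, one_mul, mul_one,
    hB, hB, MulOpposite.op_smul, TensorProduct.tmul_smul, ← TensorProduct.smul_tmul', smul_smul, smul_smul,
    add_comm (eN i) c]
  have h1 := sg_ne q hq0
  congr 2
  · simp only [kap]
    rw [betaZ_erase S i hi, cN_add]
    simp only [sg_add_left q hq0, sg_add_right q hq0]
    have e1 := h1 (cN a) (cN (eN i))
    have e2 := h1 (cN a) (cN c)
    have e3 := h1 (cN (eN i)) (cN c)
    field_simp [h1]
  · simp only [kap]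
    rw [betaZ_erase S i hi, cN_add]
    simp only [sg_add_left q hq0, sg_add_right q hq0]
    field_simp [h1]

variable (k N A) in
def epsF : (Finset (Fin N) →₀ (A ⊗[k] Aᵐᵒᵖ)) →ₗ[A ⊗[k] Aᵐᵒᵖ] A :=
  Finsupp.linearCombination _ (fun S => if S = ∅ then 1 else 0)

def idxW (N : ℕ) : (Σ _ : Finset (Fin N), (Fin N → ℕ)) ≃ (Fin N → ℕ) × Finset (Fin N) where
  toFun x := (x.2, x.1)
  invFun y := ⟨y.2, y.1⟩
  left_inv _ := rfl
  right_inv _ := rfl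

def tF : Module.Basis ((Fin N → ℕ) × Finset (Fin N)) k (Finset (Fin N) → A) :=
  (Pi.basis (fun _ : Finset (Fin N) => B)).reindex (idxW N)

theorem tF_apply (α S T) : tF B (α, S) T = if T = S then B α else 0 := by
  rw [tF, Module.Basis.reindex_apply, Pi.basis_apply]
  change (Pi.single S (B α) : Finset (Fin N) → A) T = _
  rw [Pi.single_apply]

def wF (i : Fin N) (γ : Fin N → ℤ) : k := sg q (cN (eN i)) γ - sg q γ (cN (eN i))

theorem zF_smul (hq0 : ∀ i j, q i j ≠ 0)
    (hB : ∀ a b, B a * B b = sg q (cN a) (cN b) • B (a + b)) (i T α) (hi : i ∈ T) :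
    zF q B i T • B α = wF q i (gam α (T.erase i)) • B (α + eN i) := by
  have := ae_tower (k := k) (A := A)
  have h1 := sg_ne q hq0
  rw [zF, sub_smul, smul_assoc, smul_assoc, ae_smul, ae_smul, mul_one, one_mul, hB, hB, add_comm (eN i) α,
    smul_smul, smul_smul, ← sub_smul]
  congr 1
  have : cN α = gam α (T.erase i) + betaZ N (T.erase i) := by simp [gam]
  rw [this, wF, sg_add_left q hq0, sg_add_right q hq0]
  have e1 := h1 (cN (eN i)) (betaZ N (T.erase i))
  have e2 := h1 (betaZ N (T.erase i)) (cN (eN i))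
  field_simp

theorem coK (hq0 : ∀ i j, q i j ≠ 0)
    (hB : ∀ a b, B a * B b = sg q (cN a) (cN b) • B (a + b))
    [IsScalarTower k (A ⊗[k] Aᵐᵒᵖ) A] :
    IsCoKoszul (tF B) (wF q) (delE k (zF q B)) := by
  refine (tF B).ext fun ⟨α, S⟩ => ?_
  funext T
  rw [delE_apply, LinearMap.sum_apply, Finset.sum_apply]
  rw [← Finset.sum_subset (Finset.subset_univ T)]
  · refine Finset.sum_congr rfl fun i hi => ?_
    rw [cD_t, tF_apply]
    by_cases h : T.erase i = S
    · subst h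
      rw [if_pos rfl, if_neg (by simp), smul_assoc, zF_smul q B hq0 hB i T α hi, Pi.smul_apply, tF_apply,
        if_pos (Finset.insert_erase hi).symm, smul_smul, ksgn_erase_self]
    · rw [if_neg h, smul_zero]
      split_ifs with h2
      · rfl
      · rw [Pi.smul_apply, tF_apply, if_neg, smul_zero]
        rintro rfl
        exact h (Finset.erase_insert h2)
  · intro i _ hi
    rw [cD_t]
    split_ifs with h2
    · rfl
    · rw [Pi.smul_apply, tF_apply, if_neg, smul_zero]
      rintro rfl
      exact hi (Finset.mem_insert_self _ _)

theorem general [CharZero k] (hq0 : ∀ i j, q i j ≠ 0) (hq1 : ∀ i, q i i = 1)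
    (hqinv : ∀ i j, q j i = (q i j)⁻¹) (hB1 : B 0 = 1)
    (hB : ∀ a b, B a * B b = sg q (cN a) (cN b) • B (a + b)) (m : ℕ) :
    letI := aeMod k A
    Nonempty ((↥(((Ext k (ModuleCat (A ⊗[k] Aᵐᵒᵖ)) m).obj
        (Opposite.op (ModuleCat.of (A ⊗[k] Aᵐᵒᵖ) A))).obj
        (ModuleCat.of (A ⊗[k] Aᵐᵒᵖ) A))) ≃ₗ[k]
      ({p : (Fin N → ℕ) × Finset (Fin N) //
          p.2.card = m ∧ ((fun s => ((p.1 s : ℤ))) - betaZ N p.2) ∈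
            Cg k N q (fun _ => 1)} →₀ k)) := by
  have htow := ae_tower (k := k) (A := A)
  have hC : cSet (wF q) = Cg k N q (fun _ => 1) := by
    ext γ
    simp only [cSet, Cg, Set.mem_setOf_eq, wF, sg_eq_iff q hq0 hq1 hqinv]
  have hε1 : ∀ (S : Finset (Fin N)) (r : A ⊗[k] Aᵐᵒᵖ), S.Nonempty → epsF k N A (Finsupp.single S r) = 0 := by
    intro S r hS
    rw [epsF, Finsupp.linearCombination_single, if_neg hS.ne_empty, smul_zero]
  have := abs_main (zF q B) (bF q B hq0) (bF_koszul q B hq0 hB) B (epsF k N A) ?_ hε1 ?_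
    (tF B) ?_ (wF q) (coK q B hq0 hB) m
  · rw [hC] at this
    exact this
  · intro a c
    rw [bF_apply, epsF, Finsupp.linearCombination_single, if_pos rfl, smul_assoc, ae_smul, one_mul, hB,
      smul_smul, kap]
    simp [betaZ_empty, sg_ne q hq0]
  · intro a S c hS
    rw [bF_apply, hε1 _ _ hS]
  · intro α S T h
    rw [tF_apply, if_neg h]

end genF

/-- Corollary 4.2 of the paper: for every `m`, the Hochschild cohomology
`HH^m(S_q(V)) = Ext^m_{A^e}(A, A)` is isomorphic as a `k`-vector space to the free
`k`-vector space on the set `{(α, β) ∈ ℕ^N × {0,1}^N : |β| = m, α - β ∈ C}`, where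
`C = {γ : for each i, ∏_s q_{i,s}^{γ_s} = 1 or γ_i = -1}`.  (In particular it vanishes
for `m > N`, the index set being empty.)  This is the case `g = 1`, i.e. `λ_i = 1`
for all `i`, of the twisted statement. -/
theorem stmt16 (k : Type) [Field k] [CharZero k] (N : ℕ) (hN : 0 < N)
    (q : Fin N → Fin N → k) (hq0 : ∀ i j, q i j ≠ 0) (hq1 : ∀ i, q i i = 1)
    (hqinv : ∀ i j, q j i = (q i j)⁻¹) (m : ℕ) :
    Nonempty ((↥(((Ext k (ModuleCat (QSAe k N q)) m).obj
        (Opposite.op (ModuleCat.of (QSAe k N q) (QSA k N q)))).obj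
        (ModuleCat.of (QSAe k N q) (QSA k N q)))) ≃ₗ[k]
      ({p : (Fin N → ℕ) × Finset (Fin N) //
          p.2.card = m ∧ ((fun s => ((p.1 s : ℤ))) - betaZ N p.2) ∈
            Cg k N q (fun _ => 1)} →₀ k)) := by
  obtain ⟨B, h1, h2⟩ := qsa_basis q hq0 hq1 hqinv
  exact general q B hq0 hq1 hqinv h1 h2 m
end
end

section
/- Let N = 2 and suppose q := q_{1,2} is not a root of unity. Then the Hochschild cohomology HH^m(S_q(V)) := Ext^m_{A^e}(A, A) satisfies: dim_k HH^0(S_q(V)) = 1 (with HH^0 ≅ k), dim_k HH^1(S_q(V)) = 2 (spanned by the classes of x_1 ⊗ x_1* and x_2 ⊗ x_2*), dim_k HH^2(S_q(V)) = 2 (spanned by the classes of 1 ⊗ x_1*∧x_2* and x_1 x_2 ⊗ x_1*∧x_2*), and HH^m(S_q(V)) = 0 for all m ≥ 3. -/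
attribute [local instance] Classical.propDecidable

set_option synthInstance.maxHeartbeats 1000000
set_option maxHeartbeats 1000000

noncomputable section

open scoped TensorProduct
open CategoryTheory

section CgDef
variable (k : Type) [Field k] (N : ℕ) (q : Fin N → Fin N → k) (lam : Fin N → k)

/-- The Hochschild cohomology `HH^m(S_q(V)) = Ext^m_{A^e}(A, A)`, as a `k`-vector
space (`Ext` taken in the category of left `A^e`-modules). -/
def HH (m : ℕ) : ModuleCat k :=
  ((Ext k (ModuleCat (QSAe k N q)) m).obj
    (Opposite.op (ModuleCat.of (QSAe k N q) (QSA k N q)))).obj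
    (ModuleCat.of (QSAe k N q) (QSA k N q))

end CgDef


namespace Kosz

lemma finrank_homology {k : Type} [Field k] (S : ShortComplex (ModuleCat.{0} k)) (d : ℕ)
    (p : S.X₂ →ₗ[k] (Fin d → k))
    (hsurj : ∀ w, ∃ z, S.g z = 0 ∧ p z = w)
    (hker : ∀ z, S.g z = 0 → (p z = 0 ↔ ∃ y, S.f y = z)) :
    Module.finrank k S.homology = d := by
  have e1 : S.homology ≃ₗ[k] (LinearMap.ker S.g.hom ⧸ LinearMap.range S.moduleCatToCycles) :=
    S.moduleCatHomologyIso.toLinearEquiv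
  rw [e1.finrank_eq]
  let p' : LinearMap.ker S.g.hom →ₗ[k] (Fin d → k) := p.comp (LinearMap.ker S.g.hom).subtype
  have hp' : LinearMap.range p' = ⊤ := by
    rw [LinearMap.range_eq_top]
    intro w
    obtain ⟨z, hz, hw⟩ := hsurj w
    exact ⟨⟨z, hz⟩, hw⟩
  have hk : LinearMap.ker p' = LinearMap.range S.moduleCatToCycles := by
    ext ⟨z, hz⟩
    have := hker z hz
    rw [LinearMap.mem_ker, LinearMap.mem_range]
    refine Iff.trans this ?_
    constructor
    · rintro ⟨y, hy⟩
      exact ⟨y, Subtype.ext hy⟩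
    · rintro ⟨y, hy⟩
      exact ⟨y, congrArg Subtype.val hy⟩
  rw [← hk, (p'.quotKerEquivRange).finrank_eq, hp']
  simp

section
variable {R : Type} [Ring R] (s t α β : R)

def d1 : (R × R) →ₗ[R] R :=
  LinearMap.coprod (LinearMap.toSpanSingleton R R s) (LinearMap.toSpanSingleton R R t)

def d2 : R →ₗ[R] (R × R) := LinearMap.toSpanSingleton R (R × R) (α, β)

lemma d1_apply (u : R × R) : d1 s t u = u.1 * s + u.2 * t := by simp [d1]
lemma d2_apply (w : R) : d2 α β w = (w * α, w * β) := by simp [d2]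

variable (R) in
def KX : ℕ → ModuleCat.{0} R
  | 0 => ModuleCat.of R R
  | 1 => ModuleCat.of R (R × R)
  | 2 => ModuleCat.of R R
  | _ + 3 => ModuleCat.of R PUnit

def Kd : (n : ℕ) → (KX R (n + 1) ⟶ KX R n)
  | 0 => ModuleCat.ofHom (d1 s t)
  | 1 => ModuleCat.ofHom (d2 α β)
  | _ + 2 => 0


lemma d1_d2 (h0 : α * s + β * t = 0) (w : R) : d1 s t (d2 α β w) = 0 := by
  rw [d2_apply, d1_apply]
  simp only [mul_assoc, ← mul_add, h0, mul_zero]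

variable (h0 : α * s + β * t = 0)
include h0 in
lemma Kd_sq (n : ℕ) : Kd s t α β (n + 1) ≫ Kd s t α β n = 0 := by
  match n with
  | 0 =>
    exact ModuleCat.hom_ext (LinearMap.ext fun w => d1_d2 s t α β h0 w)
  | 1 => exact Limits.zero_comp
  | n + 2 => exact Limits.zero_comp

def KC : ChainComplex (ModuleCat.{0} R) ℕ :=
  ChainComplex.of (KX R) (Kd s t α β) (Kd_sq s t α β h0)

lemma KC_d (n : ℕ) : (KC s t α β h0).d (n + 1) n = Kd s t α β n :=
  ChainComplex.of_d _ _ _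

variable {M : Type} [AddCommGroup M] [Module R M] (μ : R →ₗ[R] M)
  (hμ : Function.Surjective μ)
  (hs : ∀ w : R, w * s = 0 → w = 0) (hβ : ∀ w : R, w * β = 0 → w = 0)
  (hμs : μ s = 0) (hμt : μ t = 0)
  (hμk : ∀ r, μ r = 0 → ∃ u v, r = u * s + v * t)
  (hvt : ∀ u v : R, u * s + v * t = 0 → ∃ w, v = w * β)

lemma KC_proj (n : ℕ) : Projective ((KC s t α β h0).X n) := by
  match n with
  | 0 => exact (IsProjective.iff_projective (R := R) R).1 inferInstance
  | 1 => exact (IsProjective.iff_projective (R := R) (R × R)).1 inferInstance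
  | 2 => exact (IsProjective.iff_projective (R := R) R).1 inferInstance
  | n + 3 => exact (IsProjective.iff_projective (R := R) PUnit).1 inferInstance

include h0 hs hvt in
lemma exact1 (x : R × R) (hx : d1 s t x = 0) : ∃ w, d2 α β w = x := by
  obtain ⟨u, v⟩ := x
  rw [d1_apply] at hx
  obtain ⟨w, hw⟩ := hvt u v hx
  dsimp at hx hw
  subst hw
  refine ⟨w, ?_⟩
  rw [d2_apply]
  have : (w * α - u) * s = 0 := by
    have h1 : w * (α * s + β * t) = 0 := by rw [h0, mul_zero]
    have h2 := congrArg₂ (· - ·) h1 hx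
    simp only [sub_zero] at h2
    rw [← h2]; noncomm_ring
  rw [sub_eq_zero.1 (hs _ this)]

include hβ in
lemma exact2 (x : R) (hx : d2 α β x = 0) : 0 = x := by
  rw [d2_apply] at hx
  exact (hβ x (congrArg Prod.snd hx)).symm

include hβ hs hvt in
lemma KC_exact (n : ℕ) : (KC s t α β h0).ExactAt (n + 1) := by
  rw [HomologicalComplex.exactAt_iff' _ (n + 1 + 1) (n + 1) n (by simp) (by simp),
    ShortComplex.moduleCat_exact_iff]
  intro x hx
  change (KC s t α β h0).d (n + 1) n x = 0 at hx
  change ∃ y, (KC s t α β h0).d (n + 1 + 1) (n + 1) y = x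
  rw [KC_d] at hx
  simp only [KC_d]
  match n with
  | 0 => exact exact1 s t α β h0 hs hvt x hx
  | 1 => exact ⟨0, exact2 α β hβ x hx⟩
  | n + 2 => exact ⟨0, rfl⟩

include hμs hμt in
lemma μ_d1 (w : R × R) : μ (d1 s t w) = 0 := by
  rw [d1_apply, map_add, ← smul_eq_mul, ← smul_eq_mul, map_smul, map_smul, hμs, hμt]
  simp

include hμk in
lemma exact0 (r : R) (hr : μ r = 0) : ∃ w, d1 s t w = r := by
  obtain ⟨u, v, h⟩ := hμk r hr
  exact ⟨(u, v), by rw [d1_apply, h]⟩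

def KR : ProjectiveResolution (ModuleCat.of R M) where
  complex := KC s t α β h0
  projective := KC_proj s t α β h0
  π := (ChainComplex.toSingle₀Equiv _ _).symm ⟨ModuleCat.ofHom μ, by
    rw [KC_d]
    exact ModuleCat.hom_ext (LinearMap.ext fun w => μ_d1 s t μ hμs hμt w)⟩
  quasiIso := ⟨fun n => by
    cases n
    · rw [ChainComplex.quasiIsoAt₀_iff, ShortComplex.quasiIso_iff_of_zeros']
      · let S0 : ShortComplex (ModuleCat.{0} R) :=
          ShortComplex.mk (X₁ := (KC s t α β h0).X 1) (X₂ := (KC s t α β h0).X 0)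
            ((KC s t α β h0).d 1 0) (ModuleCat.ofHom μ) (by
            rw [KC_d]
            exact ModuleCat.hom_ext (LinearMap.ext fun w => μ_d1 s t μ hμs hμt w))
        have h1 : S0.Exact ∧ Epi S0.g := by
          constructor
          · rw [ShortComplex.moduleCat_exact_iff]
            intro x hx
            change ∃ y, (KC s t α β h0).d 1 0 y = x
            rw [KC_d]
            exact exact0 s t μ hμk x hx
          · rw [ModuleCat.epi_iff_surjective]
            exact hμ
        refine (ShortComplex.exact_and_epi_g_iff_of_iso ?_).2 h1
        exact ShortComplex.isoMk (Iso.refl _) (Iso.refl _) (Iso.refl _)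
          (by exact (Category.id_comp _).trans (Category.comp_id _).symm)
          (by
            refine (Category.id_comp _).trans (Eq.trans ?_ (Category.comp_id _).symm)
            exact (ChainComplex.toSingle₀Equiv_symm_apply_f_zero (C := KC s t α β h0)
              (X := ModuleCat.of R M) _ _).symm)
      all_goals rfl
    · rw [quasiIsoAt_iff_exactAt']
      · apply KC_exact s t α β h0 hs hβ hvt
      · apply ChainComplex.exactAt_succ_single_obj⟩

variable (k : Type) [Field k] [Algebra k R] (N : Type) [AddCommGroup N] [Module R N]
  [Module k N] [IsScalarTower k R N]

include h0 hμ hs hβ hμs hμt hμk hvt in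
lemma ext_zero (m : ℕ) (hm : 3 ≤ m) :
    Subsingleton (((Ext k (ModuleCat.{0} R) m).obj
      (Opposite.op (ModuleCat.of R M))).obj (ModuleCat.of R N)) := by
  obtain ⟨n, rfl⟩ : ∃ n, m = n + 3 := ⟨m - 3, by omega⟩
  apply ModuleCat.subsingleton_of_isZero
  refine Limits.IsZero.of_iso ?_
    ((KR s t α β h0 μ hμ hs hβ hμs hμt hμk hvt).isoExt (n + 3) (ModuleCat.of R N))
  rw [← HomologicalComplex.exactAt_iff_isZero_homology, HomologicalComplex.exactAt_iff]
  refine ShortComplex.exact_of_isZero_X₂ _ ?_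
  rw [Limits.IsZero.iff_id_eq_zero]
  ext (x : _ ⟶ _)
  have hz : Limits.IsZero ((KC s t α β h0).X (n + 3)) :=
    ModuleCat.isZero_of_subsingleton (ModuleCat.of R PUnit)
  obtain rfl : x = 0 := hz.eq_of_src _ _
  rfl

/-- evaluation at an element -/
def evL (P : Type) [AddCommGroup P] [Module R P] (e : P) :
    @LinearMap k k _ _ (RingHom.id k) (ModuleCat.of R P ⟶ ModuleCat.of R N) N
      (Preadditive.homGroup _ _).toAddCommMonoid _ (Linear.homModule _ _) _ :=
  letI : Module k (ModuleCat.of R P ⟶ ModuleCat.of R N) := Linear.homModule _ _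
  { toFun := fun φ => φ.hom e
    map_add' := fun _ _ => rfl
    map_smul' := fun c φ => by
      change algebraMap k R c • φ.hom e = c • φ.hom e
      rw [algebraMap_smul] }

def homR (a : N) : ModuleCat.of R R ⟶ ModuleCat.of R N :=
  ModuleCat.ofHom (LinearMap.toSpanSingleton R N a)

lemma homR_eq (φ : ModuleCat.of R R ⟶ ModuleCat.of R N) : φ = homR N (φ.hom 1) := by
  refine ModuleCat.hom_ext (LinearMap.ext fun r => ?_)
  change φ.hom r = r • φ.hom 1
  rw [← map_smul, smul_eq_mul, mul_one]

def homR2 (a b : N) : ModuleCat.of R (R × R) ⟶ ModuleCat.of R N :=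
  ModuleCat.ofHom (LinearMap.coprod (LinearMap.toSpanSingleton R N a) (LinearMap.toSpanSingleton R N b))

lemma homR2_eq (φ : ModuleCat.of R (R × R) ⟶ ModuleCat.of R N) :
    φ = homR2 N (φ.hom (1, 0)) (φ.hom (0, 1)) := by
  refine ModuleCat.hom_ext (LinearMap.ext fun r => ?_)
  change φ.hom r = r.1 • φ.hom (1, 0) + r.2 • φ.hom (0, 1)
  rw [← map_smul, ← map_smul, ← map_add]
  simp

lemma comp1 (a : N) : ModuleCat.ofHom (d1 s t) ≫ homR N a = homR2 N (s • a) (t • a) := by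
  refine ModuleCat.hom_ext (LinearMap.ext fun r => ?_)
  change (d1 s t r) • a = r.1 • s • a + r.2 • t • a
  rw [d1_apply, add_smul, mul_smul, mul_smul]

lemma comp2 (a b : N) : ModuleCat.ofHom (d2 α β) ≫ homR2 N a b = homR N (α • a + β • b) := by
  refine ModuleCat.hom_ext (LinearMap.ext fun r => ?_)
  change (d2 α β r).1 • a + (d2 α β r).2 • b = r • (α • a + β • b)
  rw [d2_apply, smul_add, mul_smul, mul_smul]

lemma homR_inj (a : N) : homR (R := R) N a = 0 ↔ a = 0 := by
  constructor
  · intro h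
    have : (homR (R := R) N a).hom 1 = 0 := by rw [h]; rfl
    change (1 : R) • a = 0 at this
    simpa using this
  · rintro rfl
    refine ModuleCat.hom_ext (LinearMap.ext fun r => ?_)
    change r • (0 : N) = 0
    simp

lemma homR2_inj (a b a' b' : N) : homR2 (R := R) N a b = homR2 N a' b' ↔ a = a' ∧ b = b' := by
  constructor
  · intro h
    have h1 : (homR2 (R := R) N a b).hom (1, 0) = (homR2 (R := R) N a' b').hom (1, 0) := by rw [h]
    have h2 : (homR2 (R := R) N a b).hom (0, 1) = (homR2 (R := R) N a' b').hom (0, 1) := by rw [h]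
    change (1 : R) • a + (0 : R) • b = (1 : R) • a' + (0 : R) • b' at h1
    change (0 : R) • a + (1 : R) • b = (0 : R) • a' + (1 : R) • b' at h2
    constructor
    · simpa using h1
    · simpa using h2
  · rintro ⟨rfl, rfl⟩
    rfl

include h0 hμ hs hβ hμs hμt hμk hvt in
lemma ext_dim0 (d : ℕ) (p : N →ₗ[k] (Fin d → k))
    (hsurj : ∀ w, ∃ a : N, s • a = 0 ∧ t • a = 0 ∧ p a = w)
    (hker : ∀ a : N, s • a = 0 → t • a = 0 → p a = 0 → a = 0) :
    Module.finrank k (((Ext k (ModuleCat.{0} R) 0).obj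
      (Opposite.op (ModuleCat.of R M))).obj (ModuleCat.of R N)) = d := by
  rw [((KR s t α β h0 μ hμ hs hβ hμs hμt hμk hvt).isoExt 0
    (ModuleCat.of R N)).toLinearEquiv.finrank_eq]
  let K := (KC s t α β h0).linearYonedaObj k (ModuleCat.of R N)
  change Module.finrank k (K.homology 0) = d
  rw [(K.homologyIsoSc' 0 0 1 (by simp) (by simp)).toLinearEquiv.finrank_eq]
  have hg : ∀ z : ModuleCat.of R R ⟶ ModuleCat.of R N,
      (K.sc' 0 0 1).g z = (Kd s t α β 0 ≫ z : KX R 1 ⟶ ModuleCat.of R N) := by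
    intro z
    rw [← KC_d s t α β h0]
    rfl
  have hf : (K.sc' 0 0 1).f = 0 := K.shape _ _ (by simp)
  have hz0 : ∀ z : ModuleCat.of R R ⟶ ModuleCat.of R N, (K.sc' 0 0 1).g z = 0 ↔
      (s • z.hom 1 = 0 ∧ t • z.hom 1 = 0) := by
    intro z
    rw [hg]
    change (ModuleCat.ofHom (d1 s t) ≫ z) = 0 ↔ _
    nth_rewrite 1 [homR_eq N z]
    rw [comp1]
    have : (0 : ModuleCat.of R (R × R) ⟶ ModuleCat.of R N) = homR2 N 0 0 := homR2_eq N 0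
    rw [this, homR2_inj]
  refine finrank_homology _ d (p.comp (evL (R := R) k N R 1)) ?_ ?_
  · intro w
    obtain ⟨a, h1, h2, h3⟩ := hsurj w
    have e : (homR (R := R) N a).hom 1 = a := one_smul R a
    refine ⟨homR N a, (hz0 _).2 ?_, ?_⟩
    · rw [e]; exact ⟨h1, h2⟩
    · change p ((homR (R := R) N a).hom 1) = w
      rw [e, h3]
  · intro z hz
    replace hz := (hz0 z).1 hz
    constructor
    · intro hp
      refine ⟨0, ?_⟩
      rw [map_zero]
      refine Eq.symm ?_
      refine (homR_eq N z).trans ((homR_inj N _).2 ?_)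
      exact hker _ hz.1 hz.2 hp
    · rintro ⟨y, rfl⟩
      rw [hf]
      exact map_zero (p.comp (evL (R := R) k N R 1))

include h0 hμ hs hβ hμs hμt hμk hvt in
lemma ext_dim1 (d : ℕ) (p : N × N →ₗ[k] (Fin d → k))
    (hsurj : ∀ w, ∃ a b : N, α • a + β • b = 0 ∧ p (a, b) = w)
    (hp0 : ∀ a : N, p (s • a, t • a) = 0)
    (hker : ∀ a b : N, α • a + β • b = 0 → p (a, b) = 0 → ∃ c, s • c = a ∧ t • c = b) :
    Module.finrank k (((Ext k (ModuleCat.{0} R) 1).obj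
      (Opposite.op (ModuleCat.of R M))).obj (ModuleCat.of R N)) = d := by
  rw [((KR s t α β h0 μ hμ hs hβ hμs hμt hμk hvt).isoExt 1
    (ModuleCat.of R N)).toLinearEquiv.finrank_eq]
  let K := (KC s t α β h0).linearYonedaObj k (ModuleCat.of R N)
  change Module.finrank k (K.homology 1) = d
  rw [(K.homologyIsoSc' 0 1 2 (by simp) (by simp)).toLinearEquiv.finrank_eq]
  have hg : ∀ z : ModuleCat.of R (R × R) ⟶ ModuleCat.of R N,
      (K.sc' 0 1 2).g z = (Kd s t α β 1 ≫ z : KX R 2 ⟶ ModuleCat.of R N) := by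
    intro z
    rw [← KC_d s t α β h0]
    rfl
  have hf : ∀ z : ModuleCat.of R R ⟶ ModuleCat.of R N,
      (K.sc' 0 1 2).f z = (Kd s t α β 0 ≫ z : KX R 1 ⟶ ModuleCat.of R N) := by
    intro z
    rw [← KC_d s t α β h0]
    rfl
  have hz0 : ∀ z : ModuleCat.of R (R × R) ⟶ ModuleCat.of R N, (K.sc' 0 1 2).g z = 0 ↔
      (α • z.hom (1, 0) + β • z.hom (0, 1) = 0) := by
    intro z
    rw [hg]
    change (ModuleCat.ofHom (d2 α β) ≫ z) = 0 ↔ _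
    nth_rewrite 1 [homR2_eq N z]
    rw [comp2, homR_inj]
  have e1 : ∀ a b, (homR2 (R := R) N a b).hom (1, 0) = a := by
    intro a b
    change (1 : R) • a + (0 : R) • b = a
    simp
  have e2 : ∀ a b, (homR2 (R := R) N a b).hom (0, 1) = b := by
    intro a b
    change (0 : R) • a + (1 : R) • b = b
    simp
  refine finrank_homology _ d
    (p.comp (LinearMap.prod (evL (R := R) k N (R × R) (1, 0)) (evL (R := R) k N (R × R) (0, 1)))) ?_ ?_
  · intro w
    obtain ⟨a, b, h1, h2⟩ := hsurj w
    refine ⟨homR2 N a b, (hz0 _).2 ?_, ?_⟩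
    · rw [e1, e2]; exact h1
    · change p ((homR2 (R := R) N a b).hom (1, 0), (homR2 (R := R) N a b).hom (0, 1)) = w
      rw [e1, e2, h2]
  · intro z hz
    replace hz := (hz0 z).1 hz
    constructor
    · intro hp
      obtain ⟨c, hc1, hc2⟩ := hker _ _ hz hp
      refine ⟨homR N c, (hf _).trans ?_⟩
      refine (comp1 s t N c).trans ?_
      rw [hc1, hc2]
      exact (homR2_eq N z).symm
    · rintro ⟨y, rfl⟩
      have h1 : (K.sc' 0 1 2).f y = homR2 N (s • y.hom (1 : R)) (t • y.hom (1 : R)) := by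
        refine (hf _).trans ?_
        refine Eq.trans ?_ (comp1 s t N _)
        exact congrArg (fun y => ModuleCat.ofHom (d1 s t) ≫ y) (homR_eq N y)
      rw [h1]
      have h2 : p ((homR2 (R := R) N (s • y.hom (1 : R)) (t • y.hom (1 : R))).hom (1, 0),
          (homR2 (R := R) N (s • y.hom (1 : R)) (t • y.hom (1 : R))).hom (0, 1)) = 0 := by
        rw [e1, e2, hp0]
      exact h2

include h0 hμ hs hβ hμs hμt hμk hvt in
lemma ext_dim2 (d : ℕ) (p : N →ₗ[k] (Fin d → k))
    (hsurj : ∀ w, ∃ a : N, p a = w)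
    (hp0 : ∀ a b : N, p (α • a + β • b) = 0)
    (hker : ∀ c : N, p c = 0 → ∃ a b, α • a + β • b = c) :
    Module.finrank k (((Ext k (ModuleCat.{0} R) 2).obj
      (Opposite.op (ModuleCat.of R M))).obj (ModuleCat.of R N)) = d := by
  rw [((KR s t α β h0 μ hμ hs hβ hμs hμt hμk hvt).isoExt 2
    (ModuleCat.of R N)).toLinearEquiv.finrank_eq]
  let K := (KC s t α β h0).linearYonedaObj k (ModuleCat.of R N)
  change Module.finrank k (K.homology 2) = d
  rw [(K.homologyIsoSc' 1 2 3 (by simp) (by simp)).toLinearEquiv.finrank_eq]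
  have hg : ∀ z : ModuleCat.of R R ⟶ ModuleCat.of R N,
      (K.sc' 1 2 3).g z = (0 : KX R 3 ⟶ ModuleCat.of R N) := by
    intro z
    have : (K.sc' 1 2 3).g z = (Kd s t α β 2 ≫ z : KX R 3 ⟶ ModuleCat.of R N) := by
      rw [← KC_d s t α β h0]
      rfl
    rw [this]
    exact Limits.zero_comp
  have hf : ∀ z : ModuleCat.of R (R × R) ⟶ ModuleCat.of R N,
      (K.sc' 1 2 3).f z = (Kd s t α β 1 ≫ z : KX R 2 ⟶ ModuleCat.of R N) := by
    intro z
    rw [← KC_d s t α β h0]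
    rfl
  have e : ∀ a, (homR (R := R) N a).hom 1 = a := fun a => one_smul R a
  refine finrank_homology _ d (p.comp (evL (R := R) k N R 1)) ?_ ?_
  · intro w
    obtain ⟨a, h3⟩ := hsurj w
    refine ⟨homR N a, hg _, ?_⟩
    change p ((homR (R := R) N a).hom 1) = w
    rw [e, h3]
  · intro z hz
    constructor
    · intro hp
      obtain ⟨a, b, h⟩ := hker _ hp
      refine ⟨homR2 N a b, (hf _).trans ?_⟩
      refine (comp2 α β N a b).trans ?_
      rw [h]
      exact (homR_eq N z).symm
    · rintro ⟨y, rfl⟩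
      have h1 : (K.sc' 1 2 3).f y =
          homR N (α • y.hom ((1, 0) : R × R) + β • y.hom ((0, 1) : R × R)) := by
        refine (hf _).trans ?_
        refine Eq.trans ?_ (comp2 α β N _ _)
        exact congrArg (fun y => ModuleCat.ofHom (d2 α β) ≫ y) (homR2_eq N y)
      rw [h1]
      have h2 : p ((homR (R := R) N (α • y.hom ((1, 0) : R × R) +
          β • y.hom ((0, 1) : R × R))).hom 1) = 0 := by
        rw [e, hp0]
      exact h2
end
end Kosz
namespace QPl

lemma eventually {B : Type} [Zero B] (f : ℕ → B) (N : ℕ) (hN : ∀ n, N ≤ n → f n = 0)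
    (h : ∀ n, f (n + 1) = 0 → f n = 0) (n : ℕ) : f n = 0 := by
  have key : ∀ d n, N ≤ n + d → f n = 0 := by
    intro d
    induction d with
    | zero => intro n hn; exact hN n hn
    | succ d ih => intro n hn; exact h n (ih (n + 1) (by omega))
  exact key N n (by omega)

section
variable {k : Type} [Field k] {A : Type} [Ring A] [Algebra k A] (b : Module.Basis (ℕ × ℕ) k A)
  (x y : A) (Q : k) (hxy : x * y = Q • (y * x)) (hb : ∀ i j, b (i, j) = y ^ i * x ^ j)

include hxy in
lemma x_ypow (i : ℕ) : x * y ^ i = Q ^ i • (y ^ i * x) := by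
  induction i with
  | zero => simp
  | succ i ih =>
    rw [pow_succ, ← mul_assoc, ih, smul_mul_assoc, mul_assoc, hxy, mul_smul_comm, smul_smul,
      ← mul_assoc, ← pow_succ]

include hxy in
lemma xpow_y (j : ℕ) : x ^ j * y = Q ^ j • (y * x ^ j) := by
  induction j with
  | zero => simp
  | succ j ih =>
    rw [pow_succ', mul_assoc, ih, mul_smul_comm, ← mul_assoc, hxy, smul_mul_assoc, smul_smul,
      mul_assoc, ← pow_succ]

include hxy hb

lemma x_b (i j : ℕ) : x * b (i, j) = Q ^ i • b (i, j + 1) := by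
  rw [hb, hb, ← mul_assoc, x_ypow x y Q hxy, smul_mul_assoc, mul_assoc, ← pow_succ']

omit hxy in
lemma b_x (i j : ℕ) : b (i, j) * x = b (i, j + 1) := by
  rw [hb, hb, mul_assoc, ← pow_succ]

omit hxy in
lemma y_b (i j : ℕ) : y * b (i, j) = b (i + 1, j) := by
  rw [hb, hb, ← mul_assoc, ← pow_succ']

lemma b_y (i j : ℕ) : b (i, j) * y = Q ^ j • b (i + 1, j) := by
  rw [hb, hb, mul_assoc, xpow_y x y Q hxy, mul_smul_comm, ← mul_assoc, ← pow_succ]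

lemma C_x_mul (i j : ℕ) (a : A) : b.repr (x * a) (i, j + 1) = Q ^ i * b.repr a (i, j) := by
  have : b.coord (i, j + 1) ∘ₗ LinearMap.mulLeft k x = Q ^ i • b.coord (i, j) := by
    refine b.ext ?_
    rintro ⟨i', j'⟩
    simp [x_b b x y Q hxy hb, Finsupp.single_apply]
    grind
  exact LinearMap.congr_fun this a

lemma C_x_mul0 (i : ℕ) (a : A) : b.repr (x * a) (i, 0) = 0 := by
  have : b.coord (i, 0) ∘ₗ LinearMap.mulLeft k x = 0 := by
    refine b.ext ?_
    rintro ⟨i', j'⟩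
    simp [x_b b x y Q hxy hb, Finsupp.single_apply]
  exact LinearMap.congr_fun this a

omit hxy in
lemma C_mul_x (i j : ℕ) (a : A) : b.repr (a * x) (i, j + 1) = b.repr a (i, j) := by
  have : b.coord (i, j + 1) ∘ₗ LinearMap.mulRight k x = b.coord (i, j) := by
    refine b.ext ?_
    rintro ⟨i', j'⟩
    simp [b_x b x y hb, Finsupp.single_apply]
  exact LinearMap.congr_fun this a

omit hxy in
lemma C_mul_x0 (i : ℕ) (a : A) : b.repr (a * x) (i, 0) = 0 := by
  have : b.coord (i, 0) ∘ₗ LinearMap.mulRight k x = 0 := by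
    refine b.ext ?_
    rintro ⟨i', j'⟩
    simp [b_x b x y hb, Finsupp.single_apply]
  exact LinearMap.congr_fun this a

omit hxy in
lemma C_y_mul (i j : ℕ) (a : A) : b.repr (y * a) (i + 1, j) = b.repr a (i, j) := by
  have : b.coord (i + 1, j) ∘ₗ LinearMap.mulLeft k y = b.coord (i, j) := by
    refine b.ext ?_
    rintro ⟨i', j'⟩
    simp [y_b b x y hb, Finsupp.single_apply]
  exact LinearMap.congr_fun this a

omit hxy in
lemma C_y_mul0 (j : ℕ) (a : A) : b.repr (y * a) (0, j) = 0 := by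
  have : b.coord (0, j) ∘ₗ LinearMap.mulLeft k y = 0 := by
    refine b.ext ?_
    rintro ⟨i', j'⟩
    simp [y_b b x y hb, Finsupp.single_apply]
  exact LinearMap.congr_fun this a

lemma C_mul_y (i j : ℕ) (a : A) : b.repr (a * y) (i + 1, j) = Q ^ j * b.repr a (i, j) := by
  have : b.coord (i + 1, j) ∘ₗ LinearMap.mulRight k y = Q ^ j • b.coord (i, j) := by
    refine b.ext ?_
    rintro ⟨i', j'⟩
    simp [b_y b x y Q hxy hb, Finsupp.single_apply]
    grind
  exact LinearMap.congr_fun this a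

lemma C_mul_y0 (j : ℕ) (a : A) : b.repr (a * y) (0, j) = 0 := by
  have : b.coord (0, j) ∘ₗ LinearMap.mulRight k y = 0 := by
    refine b.ext ?_
    rintro ⟨i', j'⟩
    simp [b_y b x y Q hxy hb, Finsupp.single_apply]
  exact LinearMap.congr_fun this a

variable (hQ : ∀ n, 0 < n → Q ^ n ≠ 1) (hQ0 : Q ≠ 0)

include hQ

lemma center (a : A) (h1 : x * a - a * x = 0) (h2 : y * a - a * y = 0)
    (h3 : b.repr a (0, 0) = 0) : a = 0 := by
  refine b.ext_elem ?_
  rintro ⟨i, j⟩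
  rw [map_zero, Finsupp.zero_apply]
  by_cases hi : 0 < i
  · have := congrArg (fun z => b.repr z (i, j + 1)) h1
    simp only [map_sub, Finsupp.sub_apply, C_x_mul b x y Q hxy hb, C_mul_x b x y hb, map_zero,
      Finsupp.zero_apply] at this
    have h : (Q ^ i - 1) * b.repr a (i, j) = 0 := by rw [← this]; ring
    exact (mul_eq_zero.1 h).resolve_left (sub_ne_zero.2 (hQ i hi))
  by_cases hj : 0 < j
  · have := congrArg (fun z => b.repr z (i + 1, j)) h2
    simp only [map_sub, Finsupp.sub_apply, C_mul_y b x y Q hxy hb, C_y_mul b x y hb, map_zero,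
      Finsupp.zero_apply] at this
    have h : (Q ^ j - 1) * b.repr a (i, j) = 0 := by rw [← neg_eq_zero, ← this]; ring
    exact (mul_eq_zero.1 h).resolve_left (sub_ne_zero.2 (hQ j hj))
  obtain rfl : i = 0 := by omega
  obtain rfl : j = 0 := by omega
  exact h3

include hQ0 in
lemma sub_ne (n : ℕ) (hn : n ≠ 1) : Q ^ n - Q ≠ 0 := by
  intro h
  rw [sub_eq_zero] at h
  rcases Nat.eq_zero_or_pos n with rfl | h0
  · exact hQ 1 one_pos (by rw [← h]; simp)
  · refine hQ (n - 1) (by omega) ?_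
    have : Q ^ (n - 1) * Q = 1 * Q := by rw [← pow_succ, Nat.sub_add_cancel h0, h, one_mul]
    exact mul_right_cancel₀ hQ0 this

include hQ0

lemma coker (c : A) (h0 : b.repr c (0, 0) = 0) (h1 : b.repr c (1, 1) = 0) :
    ∃ a a' : A, (a * y - Q • (y * a)) + (x * a' - Q • (a' * x)) = c := by
  let δ : A × A →ₗ[k] A := LinearMap.coprod
    (LinearMap.mulRight k y - Q • LinearMap.mulLeft k y)
    (LinearMap.mulLeft k x - Q • LinearMap.mulRight k x)
  suffices h : c ∈ LinearMap.range δ by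
    obtain ⟨⟨a, a'⟩, h⟩ := h
    exact ⟨a, a', h⟩
  have e1 : ∀ i j, j ≠ 1 → b (i + 1, j) ∈ LinearMap.range δ := by
    intro i j hj
    refine ⟨(Q ^ j - Q)⁻¹ • (b (i, j), 0), ?_⟩
    rw [map_smul]
    simp [δ, b_y b x y Q hxy hb, y_b b x y hb]
    rw [← sub_smul, smul_smul, inv_mul_cancel₀ (sub_ne b x y Q hxy hb hQ hQ0 j hj), one_smul]
  have e2 : ∀ i j, i ≠ 1 → b (i, j + 1) ∈ LinearMap.range δ := by
    intro i j hj
    refine ⟨(Q ^ i - Q)⁻¹ • (0, b (i, j)), ?_⟩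
    rw [map_smul]
    simp [δ, x_b b x y Q hxy hb, b_x b x y hb]
    rw [← sub_smul, smul_smul, inv_mul_cancel₀ (sub_ne b x y Q hxy hb hQ hQ0 i hj), one_smul]
  rw [← b.linearCombination_repr c, Finsupp.linearCombination_apply]
  refine Submodule.sum_mem _ ?_
  rintro ⟨i, j⟩ -
  by_cases h00 : b.repr c (i, j) = 0
  · simp only [h00, zero_smul]; exact Submodule.zero_mem _
  refine Submodule.smul_mem _ _ ?_
  rcases i with _ | i
  · rcases j with _ | j
    · exact absurd h0 h00
    · exact e2 0 j (by omega)
  · by_cases hj : j = 1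
    · subst hj
      refine e2 (i + 1) 0 ?_
      intro hi
      rw [hi] at h00
      exact h00 h1
    · exact e1 i j hj

lemma cocycle (a a' : A) (h : (a * y - Q • (y * a)) + (x * a' - Q • (a' * x)) = 0)
    (h1 : b.repr a (0, 1) = 0) (h2 : b.repr a' (1, 0) = 0) :
    ∃ c : A, x * c - c * x = a ∧ y * c - c * y = a' := by
  have hc : ∀ p, b.repr ((a * y - Q • (y * a)) + (x * a' - Q • (a' * x))) p = 0 := by
    intro p; rw [h]; simp
  simp only [map_add, map_sub, map_smul, Finsupp.add_apply, Finsupp.sub_apply,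
    Finsupp.smul_apply, smul_eq_mul] at hc
  have ha0 : ∀ i, b.repr a (i, 0) = 0 := by
    intro i
    have := hc (i + 1, 0)
    rw [C_mul_y b x y Q hxy hb, C_y_mul b x y hb, C_x_mul0 b x y Q hxy hb, C_mul_x0 b x y hb] at this
    have h : (Q ^ 0 - Q) * b.repr a (i, 0) = 0 := by rw [← this]; ring
    exact (mul_eq_zero.1 h).resolve_left (sub_ne b x y Q hxy hb hQ hQ0 0 (by omega))
  have hb0 : ∀ j, b.repr a' (0, j) = 0 := by
    intro j
    have := hc (0, j + 1)
    rw [C_x_mul b x y Q hxy hb, C_mul_x b x y hb, C_mul_y0 b x y Q hxy hb, C_y_mul0 b x y hb] at this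
    have h : (Q ^ 0 - Q) * b.repr a' (0, j) = 0 := by rw [← this]; ring
    exact (mul_eq_zero.1 h).resolve_left (sub_ne b x y Q hxy hb hQ hQ0 0 (by omega))
  have hab : ∀ i j, b.repr a (i, j + 1) * (Q ^ j - 1) + b.repr a' (i + 1, j) * (Q ^ i - 1) = 0 := by
    intro i j
    have := hc (i + 1, j + 1)
    rw [C_x_mul b x y Q hxy hb, C_mul_x b x y hb, C_mul_y b x y Q hxy hb, C_y_mul b x y hb] at this
    have h : Q * (b.repr a (i, j + 1) * (Q ^ j - 1) + b.repr a' (i + 1, j) * (Q ^ i - 1)) = 0 := by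
      rw [← this]; ring
    exact (mul_eq_zero.1 h).resolve_left hQ0
  let f : ℕ × ℕ → k := fun p => if 0 < p.1 then b.repr a (p.1, p.2 + 1) / (Q ^ p.1 - 1)
    else b.repr a' (p.1 + 1, p.2) / (1 - Q ^ p.2)
  have hf : (Function.support f).Finite := by
    have f1 : ((fun p : ℕ × ℕ => (p.1, p.2 + 1)) ⁻¹' ((b.repr a).support : Set (ℕ × ℕ))).Finite := by
      refine Set.Finite.preimage ?_ (Finset.finite_toSet _)
      rintro ⟨_, _⟩ _ ⟨_, _⟩ _ h
      simpa using h
    have f2 : ((fun p : ℕ × ℕ => (p.1 + 1, p.2)) ⁻¹' ((b.repr a').support : Set (ℕ × ℕ))).Finite := by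
      refine Set.Finite.preimage ?_ (Finset.finite_toSet _)
      rintro ⟨_, _⟩ _ ⟨_, _⟩ _ h
      simpa using h
    refine (f1.union f2).subset ?_
    rintro ⟨i, j⟩ hp
    rw [Function.mem_support] at hp
    by_contra hn
    simp only [Set.mem_union, Set.mem_preimage, Finset.mem_coe, Finsupp.mem_support_iff, not_or,
      not_not] at hn
    apply hp
    simp only [f, hn.1, hn.2, zero_div, ite_self]
  let c : A := b.repr.symm (Finsupp.ofSupportFinite f hf)
  have hcr : ∀ p, b.repr c p = f p := by
    intro p; simp only [c, LinearEquiv.apply_symm_apply]; rfl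
  have hfa : ∀ i j, (Q ^ i - 1) * f (i, j) = b.repr a (i, j + 1) := by
    intro i j
    rcases Nat.eq_zero_or_pos i with rfl | hi
    · rw [pow_zero, sub_self, zero_mul]
      have := hab 0 j
      rcases Nat.eq_zero_or_pos j with rfl | hj
      · exact h1.symm
      · simp only [pow_zero, sub_self, mul_zero, add_zero] at this
        exact ((mul_eq_zero.1 this).resolve_right (sub_ne_zero.2 (hQ j hj))).symm
    · simp only [f, hi, if_true]
      exact mul_div_cancel₀ _ (sub_ne_zero.2 (hQ i hi))
  have hfb : ∀ i j, (1 - Q ^ j) * f (i, j) = b.repr a' (i + 1, j) := by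
    intro i j
    have hij := hab i j
    rcases Nat.eq_zero_or_pos i with rfl | hi
    · rcases Nat.eq_zero_or_pos j with rfl | hj
      · simpa using h2.symm
      · simp only [f, lt_irrefl, if_false]
        exact mul_div_cancel₀ _ (sub_ne_zero.2 (hQ j hj).symm)
    · have hne := sub_ne_zero.2 (hQ i hi)
      apply mul_left_cancel₀ hne
      have := hfa i j
      linear_combination (1 - Q ^ j) * this - hij
  refine ⟨c, ?_, ?_⟩
  · refine b.ext_elem ?_
    rintro ⟨i, j⟩
    rw [map_sub, Finsupp.sub_apply]
    rcases j with _ | j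
    · rw [C_x_mul0 b x y Q hxy hb, C_mul_x0 b x y hb, ha0, sub_zero]
    · rw [C_x_mul b x y Q hxy hb, C_mul_x b x y hb, hcr, ← hfa]; ring
  · refine b.ext_elem ?_
    rintro ⟨i, j⟩
    rw [map_sub, Finsupp.sub_apply]
    rcases i with _ | i
    · rw [C_mul_y0 b x y Q hxy hb, C_y_mul0 b x y hb, hb0, sub_zero]
    · rw [C_mul_y b x y Q hxy hb, C_y_mul b x y hb, hcr, ← hfb]; ring

end
end QPl
namespace QPl
section
variable {k : Type} [Field k] {A : Type} [Ring A] [Algebra k A] (b : Module.Basis (ℕ × ℕ) k A)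
  (x y : A) (Q : k)

open MulOpposite

/-- right multiplication by an element, as a `k`-linear map -/
def E : (A ⊗[k] Aᵐᵒᵖ) ≃ₗ[k] (ℕ × ℕ →₀ Aᵐᵒᵖ) := TensorProduct.equivFinsuppOfBasisLeft b

lemma E_tmul (a : A) (n : Aᵐᵒᵖ) (p : ℕ × ℕ) : E b (a ⊗ₜ n) p = b.repr a p • n :=
  TensorProduct.equivFinsuppOfBasisLeft_apply_tmul_apply b a n p

lemma E_symm_single (p : ℕ × ℕ) (n : Aᵐᵒᵖ) : (E b).symm (Finsupp.single p n) = b p ⊗ₜ n := by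
  simp [E]

lemma E_b (p : ℕ × ℕ) (n : Aᵐᵒᵖ) : E b (b p ⊗ₜ n) = Finsupp.single p n := by
  rw [← E_symm_single, LinearEquiv.apply_symm_apply]

lemma ind (P : A ⊗[k] Aᵐᵒᵖ → Prop) (h0 : P 0) (hadd : ∀ u v, P u → P v → P (u + v))
    (h : ∀ i j n, P (b (i, j) ⊗ₜ n)) (v : A ⊗[k] Aᵐᵒᵖ) : P v := by
  obtain ⟨f, rfl⟩ := (E b).symm.surjective v
  induction f using Finsupp.induction_linear with
  | zero => rw [map_zero]; exact h0
  | add f g hf hg => rw [map_add]; exact hadd _ _ hf hg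
  | single p n => rw [E_symm_single]; exact h p.1 p.2 n

def bet (c : k) : A ⊗[k] Aᵐᵒᵖ := x ⊗ₜ 1 - c • (1 ⊗ₜ op x)

lemma tmul_bet (c : k) (a : A) (n : Aᵐᵒᵖ) :
    (a ⊗ₜ[k] n) * bet x c = (a * x) ⊗ₜ n - c • (a ⊗ₜ (n * op x)) := by
  rw [bet, mul_sub, mul_smul_comm, Algebra.TensorProduct.tmul_mul_tmul,
    Algebra.TensorProduct.tmul_mul_tmul, mul_one, mul_one]

variable (hb : ∀ i j, b (i, j) = y ^ i * x ^ j)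

include hb in
lemma E_mul_bet (c : k) (v : A ⊗[k] Aᵐᵒᵖ) (i j : ℕ) :
    E b (v * bet x c) (i, j + 1) = E b v (i, j) - c • (E b v (i, j + 1) * op x) := by
  induction v using TensorProduct.induction_on with
  | zero => simp
  | add u v hu hv =>
    simp only [add_mul, map_add, Finsupp.add_apply, hu, hv, smul_add]; abel
  | tmul a n =>
    rw [tmul_bet, map_sub, map_smul, Finsupp.sub_apply, Finsupp.smul_apply, E_tmul, E_tmul, E_tmul,
      E_tmul, C_mul_x b x y hb, smul_mul_assoc]

include hb in
lemma bet_reg (c : k) (v : A ⊗[k] Aᵐᵒᵖ) (hv : v * bet x c = 0) : v = 0 := by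
  apply (E b).injective
  rw [map_zero]
  ext1 ⟨i, j⟩
  rw [Finsupp.zero_apply]
  refine eventually (fun j => E b v (i, j)) ((E b v).support.sup Prod.snd + 1) ?_ ?_ j
  · intro n hn
    by_contra h
    have h1 : (i, n) ∈ (E b v).support := Finsupp.mem_support_iff.2 h
    have := Finset.le_sup (f := Prod.snd) h1
    dsimp at this
    omega
  · intro n hn
    have hn' : E b v (i, n + 1) = 0 := hn
    have := E_mul_bet b x y hb c v i n
    rw [hv, map_zero, Finsupp.zero_apply, hn'] at this
    simpa using this.symm

/-- the quotient map by the left ideal generated by `bet` -/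
def phi (c : k) : (A ⊗[k] Aᵐᵒᵖ) →ₗ[k] (ℕ →₀ Aᵐᵒᵖ) :=
  (Finsupp.lsum k (fun p : ℕ × ℕ => (Finsupp.lsingle p.1 : Aᵐᵒᵖ →ₗ[k] (ℕ →₀ Aᵐᵒᵖ)) ∘ₗ
    (c ^ p.2 • LinearMap.mulRight k (op x ^ p.2)))) ∘ₗ (E b).toLinearMap

lemma phi_b (c : k) (i j : ℕ) (n : Aᵐᵒᵖ) :
    phi b x c (b (i, j) ⊗ₜ n) = Finsupp.single i (c ^ j • (n * op x ^ j)) := by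
  rw [phi, LinearMap.comp_apply, LinearEquiv.coe_coe, E_b, Finsupp.lsum_single,
    LinearMap.comp_apply, Finsupp.lsingle_apply, LinearMap.smul_apply, LinearMap.mulRight_apply]

include hb in
lemma phi_s (u : A ⊗[k] Aᵐᵒᵖ) : phi b x 1 (u * bet x 1) = 0 := by
  refine ind b (fun u => phi b x 1 (u * bet x 1) = 0) ?_ ?_ ?_ u
  · simp
  · intro u v hu hv
    rw [add_mul, map_add, hu, hv, add_zero]
  · intro i j n
    rw [tmul_bet, b_x b x y hb, one_smul, map_sub, phi_b, phi_b, one_pow, one_pow, one_smul,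
      one_smul, mul_assoc, ← pow_succ', sub_self]

def tt : A ⊗[k] Aᵐᵒᵖ := y ⊗ₜ 1 - 1 ⊗ₜ op y

lemma tmul_tt (a : A) (n : Aᵐᵒᵖ) :
    (a ⊗ₜ[k] n) * tt y = (a * y) ⊗ₜ n - a ⊗ₜ (n * op y) := by
  rw [tt, mul_sub, Algebra.TensorProduct.tmul_mul_tmul,
    Algebra.TensorProduct.tmul_mul_tmul, mul_one, mul_one]

variable (hxy : x * y = Q • (y * x))

include hb hxy in
lemma phi_t (v : A ⊗[k] Aᵐᵒᵖ) (i : ℕ) :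
    phi b x 1 (v * tt y) (i + 1) = phi b x Q v i - phi b x Q v (i + 1) * op y := by
  refine ind b (fun v => phi b x 1 (v * tt y) (i + 1) =
    phi b x Q v i - phi b x Q v (i + 1) * op y) ?_ ?_ ?_ v
  · simp
  · intro u v hu hv
    simp only [add_mul, map_add, Finsupp.add_apply, hu, hv]; abel
  · intro i' j n
    have hop : op y * op x ^ j = Q ^ j • (op x ^ j * op y) := by
      rw [← op_pow, ← op_mul, ← op_mul, xpow_y x y Q hxy, op_smul]
    rw [tmul_tt, b_y b x y Q hxy hb, ← TensorProduct.smul_tmul', map_sub, map_smul, phi_b, phi_b,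
      phi_b, one_pow, one_smul, one_smul, mul_assoc, hop, Finsupp.sub_apply,
      Finsupp.smul_apply]
    simp only [Finsupp.single_apply, add_left_inj]
    have e : n * Q ^ j • (op x ^ j * op y) = Q ^ j • (n * op x ^ j) * op y := by
      rw [mul_smul_comm, smul_mul_assoc, mul_assoc]
    rw [e]
    split_ifs <;> simp

def sig : (ℕ →₀ Aᵐᵒᵖ) →ₗ[k] (A ⊗[k] Aᵐᵒᵖ) :=
  Finsupp.lsum k (fun i => TensorProduct.mk k A Aᵐᵒᵖ (b (i, 0)))

lemma sig_single (i : ℕ) (n : Aᵐᵒᵖ) : sig b (Finsupp.single i n) = b (i, 0) ⊗ₜ n := by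
  simp [sig]

include hb in
lemma sig_phi (c : k) (v : A ⊗[k] Aᵐᵒᵖ) : ∃ w, v - sig b (phi b x c v) = w * bet x c := by
  refine ind b (fun v => ∃ w, v - sig b (phi b x c v) = w * bet x c) ?_ ?_ ?_ v
  · exact ⟨0, by simp⟩
  · rintro u v ⟨w, hw⟩ ⟨w', hw'⟩
    refine ⟨w + w', ?_⟩
    rw [add_mul, ← hw, ← hw', map_add, map_add]; abel
  · intro i j
    induction j with
    | zero => intro n; exact ⟨0, by rw [phi_b, sig_single]; simp⟩
    | succ j ih =>
      intro n
      obtain ⟨w, hw⟩ := ih (n * op x)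
      refine ⟨b (i, j) ⊗ₜ n + c • w, ?_⟩
      rw [add_mul, tmul_bet, smul_mul_assoc, ← hw, b_x b x y hb, phi_b, phi_b, sig_single,
        sig_single, pow_succ' (op x), mul_assoc, pow_succ' c, mul_smul, TensorProduct.tmul_smul c,
        smul_sub]
      abel

include hb hxy in
lemma hvt (u v : A ⊗[k] Aᵐᵒᵖ) (h : u * bet x 1 + v * tt y = 0) : ∃ w, v = w * bet x Q := by
  have h1 : phi b x 1 (v * tt y) = 0 := by
    have := congrArg (phi b x 1) h
    rwa [map_add, phi_s b x y hb, zero_add, map_zero] at this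
  have h2 : phi b x Q v = 0 := by
    ext1 i
    rw [Finsupp.zero_apply]
    refine eventually (fun i => phi b x Q v i) ((phi b x Q v).support.sup id + 1) ?_ ?_ i
    · intro n hn
      by_contra h
      have h1 : n ∈ (phi b x Q v).support := Finsupp.mem_support_iff.2 h
      have := Finset.le_sup (f := id) h1
      dsimp at this
      omega
    · intro n hn
      have hn' : phi b x Q v (n + 1) = 0 := hn
      have := phi_t b x y Q hb hxy v n
      rw [h1, hn'] at this
      simpa using this.symm
  obtain ⟨w, hw⟩ := sig_phi b x y hb Q v
  exact ⟨w, by rw [← hw, h2, map_zero, sub_zero]⟩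

def alp : A ⊗[k] Aᵐᵒᵖ := 1 ⊗ₜ op y - Q • (y ⊗ₜ 1)

include hxy in
lemma h00 : alp y Q * bet x 1 + bet x Q * tt y = 0 := by
  have hop : op y * op x = Q • (op x * op y) := by
    rw [← op_mul, ← op_mul, hxy, op_smul]
  rw [alp, sub_mul, smul_mul_assoc, tmul_bet, tmul_bet, bet, sub_mul, smul_mul_assoc, tmul_tt,
    tmul_tt, hop, hxy]
  simp only [one_mul, one_smul, smul_sub, TensorProduct.tmul_smul, ← TensorProduct.smul_tmul']
  abel

section
variable [Module (A ⊗[k] Aᵐᵒᵖ) A] (hmod : ∀ a c d : A, (a ⊗ₜ[k] op d : A ⊗[k] Aᵐᵒᵖ) • c = a * c * d)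

include hmod

lemma tower : IsScalarTower k (A ⊗[k] Aᵐᵒᵖ) A := by
  constructor
  intro c r a
  induction r using TensorProduct.induction_on with
  | zero =>
    have h1 : (0 : A ⊗[k] Aᵐᵒᵖ) • a = 0 := by
      have h := hmod 0 a 0
      rwa [TensorProduct.zero_tmul, zero_mul, zero_mul] at h
    rw [smul_zero]
    exact h1.trans ((congrArg (c • ·) h1).trans (smul_zero c)).symm
  | add u v hu hv => rw [smul_add, add_smul, add_smul, smul_add, hu, hv]
  | tmul a' n =>
    obtain ⟨n, rfl⟩ := op_surjective n
    rw [TensorProduct.smul_tmul', hmod, hmod, smul_mul_assoc, smul_mul_assoc]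

lemma smul_bet (c : k) (a : A) : (bet x c : A ⊗[k] Aᵐᵒᵖ) • a = x * a - c • (a * x) := by
  have := tower hmod
  rw [bet, sub_smul, smul_assoc, ← op_one, hmod, hmod, mul_one, one_mul]

lemma smul_tt (a : A) : (tt y : A ⊗[k] Aᵐᵒᵖ) • a = y * a - a * y := by
  rw [tt, sub_smul, ← op_one, hmod, hmod, mul_one, one_mul]

lemma smul_alp (a : A) : (alp y Q : A ⊗[k] Aᵐᵒᵖ) • a = a * y - Q • (y * a) := by
  have := tower hmod
  rw [alp, sub_smul, smul_assoc, ← op_one, hmod, hmod, mul_one, one_mul]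

include hb in
lemma ker_mu (r : A ⊗[k] Aᵐᵒᵖ) (hr : r • (1 : A) = 0) :
    ∃ u v, r = u * bet x 1 + v * tt y := by
  have hto := tower hmod
  let J : Submodule (A ⊗[k] Aᵐᵒᵖ) (A ⊗[k] Aᵐᵒᵖ) := Submodule.span _ {bet x 1, tt y}
  have hsJ : bet x 1 ∈ J := Submodule.subset_span (by simp)
  have htJ : tt y ∈ J := Submodule.subset_span (by simp)
  have hprod : ∀ c d : A, (1 ⊗ₜ op c - c ⊗ₜ 1 : A ⊗[k] Aᵐᵒᵖ) ∈ J →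
      (1 ⊗ₜ op d - d ⊗ₜ 1 : A ⊗[k] Aᵐᵒᵖ) ∈ J →
      (1 ⊗ₜ op (c * d) - (c * d) ⊗ₜ 1 : A ⊗[k] Aᵐᵒᵖ) ∈ J := by
    intro c d hc hd
    have e : (1 ⊗ₜ op (c * d) - (c * d) ⊗ₜ 1 : A ⊗[k] Aᵐᵒᵖ) =
        (1 ⊗ₜ op d : A ⊗[k] Aᵐᵒᵖ) • (1 ⊗ₜ op c - c ⊗ₜ 1 : A ⊗[k] Aᵐᵒᵖ) +
        (c ⊗ₜ 1 : A ⊗[k] Aᵐᵒᵖ) • (1 ⊗ₜ op d - d ⊗ₜ 1 : A ⊗[k] Aᵐᵒᵖ) := by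
      simp only [smul_eq_mul, mul_sub, Algebra.TensorProduct.tmul_mul_tmul, one_mul, mul_one,
        op_mul]
      abel
    rw [e]
    exact J.add_mem (J.smul_mem _ hc) (J.smul_mem _ hd)
  have hx : (1 ⊗ₜ op x - x ⊗ₜ 1 : A ⊗[k] Aᵐᵒᵖ) ∈ J := by
    have := J.neg_mem hsJ
    rwa [bet, one_smul, neg_sub] at this
  have hy : (1 ⊗ₜ op y - y ⊗ₜ 1 : A ⊗[k] Aᵐᵒᵖ) ∈ J := by
    have := J.neg_mem htJ
    rwa [tt, neg_sub] at this
  have hone : (1 ⊗ₜ op 1 - 1 ⊗ₜ 1 : A ⊗[k] Aᵐᵒᵖ) ∈ J := by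
    rw [op_one, sub_self]; exact J.zero_mem
  have hpow : ∀ c : A, (1 ⊗ₜ op c - c ⊗ₜ 1 : A ⊗[k] Aᵐᵒᵖ) ∈ J → ∀ n : ℕ,
      (1 ⊗ₜ op (c ^ n) - (c ^ n) ⊗ₜ 1 : A ⊗[k] Aᵐᵒᵖ) ∈ J := by
    intro c hc n
    induction n with
    | zero => rw [pow_zero]; exact hone
    | succ n ih => rw [pow_succ]; exact hprod _ _ ih hc
  have hall : ∀ c : A, (1 ⊗ₜ op c - c ⊗ₜ 1 : A ⊗[k] Aᵐᵒᵖ) ∈ J := by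
    intro c
    have hc : c ∈ Submodule.span k (Set.range b) := by rw [b.span_eq]; trivial
    induction hc using Submodule.span_induction with
    | mem c hc =>
      obtain ⟨⟨i, j⟩, rfl⟩ := hc
      rw [hb]
      exact hprod _ _ (hpow y hy i) (hpow x hx j)
    | zero =>
      rw [op_zero, TensorProduct.tmul_zero, TensorProduct.zero_tmul, sub_zero]
      exact J.zero_mem
    | add c d _ _ hc hd =>
      rw [MulOpposite.op_add, TensorProduct.tmul_add, TensorProduct.add_tmul, add_sub_add_comm]
      exact J.add_mem hc hd
    | smul r c _ hc =>
      have := J.smul_mem (algebraMap k _ r) hc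
      rw [algebraMap_smul, smul_sub] at this
      rw [op_smul, TensorProduct.tmul_smul, ← TensorProduct.smul_tmul']
      exact this
  have hr' : ∀ r : A ⊗[k] Aᵐᵒᵖ, r - (r • (1 : A)) ⊗ₜ 1 ∈ J := by
    intro r
    induction r using TensorProduct.induction_on with
    | zero =>
      have h1 : (0 : A ⊗[k] Aᵐᵒᵖ) • (1 : A) = 0 := by
        have h := hmod 0 1 0
        rwa [TensorProduct.zero_tmul, zero_mul, zero_mul] at h
      have h2 : (0 : A ⊗[k] Aᵐᵒᵖ) - ((0 : A ⊗[k] Aᵐᵒᵖ) • (1 : A)) ⊗ₜ 1 = 0 := by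
        rw [h1, TensorProduct.zero_tmul, sub_zero]
      have h3 := J.zero_mem
      rw [← h2] at h3
      exact h3
    | add u v hu hv =>
      have := J.add_mem hu hv
      rw [add_smul, TensorProduct.add_tmul]
      convert this using 1
      abel
    | tmul a n =>
      obtain ⟨n, rfl⟩ := op_surjective n
      have := J.smul_mem (a ⊗ₜ 1 : A ⊗[k] Aᵐᵒᵖ) (hall n)
      rw [hmod, mul_one]
      simpa only [smul_eq_mul, mul_sub, Algebra.TensorProduct.tmul_mul_tmul, one_mul, mul_one]
        using this
  have := hr' r
  rw [hr, TensorProduct.zero_tmul, sub_zero] at this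
  obtain ⟨u, v, h⟩ := Submodule.mem_span_pair.1 this
  exact ⟨u, v, h.symm⟩

end
end
end QPl
namespace QBas
section
variable (k : Type) [Field k] (q : Fin 2 → Fin 2 → k)

abbrev M := ℕ × ℕ →₀ k

def rx : M k →ₗ[k] M k :=
  Finsupp.lsum k (fun p : ℕ × ℕ => q 0 1 ^ p.1 • (Finsupp.lsingle (p.1, p.2 + 1) : k →ₗ[k] M k))

def ry : M k →ₗ[k] M k :=
  Finsupp.lsum k (fun p : ℕ × ℕ => (Finsupp.lsingle (p.1 + 1, p.2) : k →ₗ[k] M k))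

lemma rx_single (i j : ℕ) (c : k) :
    rx k q (Finsupp.single (i, j) c) = q 0 1 ^ i • Finsupp.single (i, j + 1) c := by
  rw [rx, Finsupp.lsum_single, LinearMap.smul_apply, Finsupp.lsingle_apply]

lemma ry_single (i j : ℕ) (c : k) :
    ry k (Finsupp.single (i, j) c) = Finsupp.single (i + 1, j) c := by
  rw [ry, Finsupp.lsum_single, Finsupp.lsingle_apply]

lemma rxy : rx k q * ry k = q 0 1 • (ry k * rx k q) := by
  refine Finsupp.lhom_ext ?_
  rintro ⟨i, j⟩ c
  rw [LinearMap.smul_apply, Module.End.mul_apply, Module.End.mul_apply, ry_single, rx_single, rx_single,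
    map_smul, ry_single, smul_smul, ← pow_succ']

def rgen : Fin 2 → Module.End k (M k) := ![rx k q, ry k]

variable (hq0 : ∀ i j, q i j ≠ 0) (hq1 : ∀ i, q i i = 1) (hqinv : ∀ i j, q j i = (q i j)⁻¹)

include hq0 hq1 hqinv in
lemma rgen_rel (i j : Fin 2) : rgen k q i * rgen k q j = q i j • (rgen k q j * rgen k q i) := by
  fin_cases i <;> fin_cases j
  · show rx k q * rx k q = q 0 0 • (rx k q * rx k q)
    rw [hq1, one_smul]
  · exact rxy k q
  · show ry k * rx k q = q 1 0 • (rx k q * ry k)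
    rw [rxy, smul_smul, hqinv 0 1, inv_mul_cancel₀ (hq0 0 1), one_smul]
  · show ry k * ry k = q 1 1 • (ry k * ry k)
    rw [hq1, one_smul]

def rho : QSA k 2 q →ₐ[k] Module.End k (M k) :=
  RingQuot.liftAlgHom k
    ⟨FreeAlgebra.lift k (rgen k q), by
      intro x y h
      induction h with
      | rel i j =>
        simp only [map_mul, map_smul, FreeAlgebra.lift_ι_apply]
        exact rgen_rel k q hq0 hq1 hqinv i j⟩

lemma rho_X (i : Fin 2) : rho k q hq0 hq1 hqinv (X k 2 q i) = rgen k q i := by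
  rw [rho, X, RingQuot.liftAlgHom_mkAlgHom_apply, FreeAlgebra.lift_ι_apply]

lemma hxy : X k 2 q 0 * X k 2 q 1 = q 0 1 • (X k 2 q 1 * X k 2 q 0) := by
  simpa only [X, map_mul, map_smul] using
    RingQuot.mkAlgHom_rel k (QRel.rel (k := k) (N := 2) (q := q) 0 1)

def g : M k →ₗ[k] QSA k 2 q :=
  Finsupp.linearCombination k (fun p : ℕ × ℕ => X k 2 q 1 ^ p.1 * X k 2 q 0 ^ p.2)

lemma g_single (i j : ℕ) (c : k) :
    g k q (Finsupp.single (i, j) c) = c • (X k 2 q 1 ^ i * X k 2 q 0 ^ j) := by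
  rw [g, Finsupp.linearCombination_single]

def f : QSA k 2 q →ₗ[k] M k :=
  (LinearMap.applyₗ (Finsupp.single (0, 0) (1 : k))).comp (rho k q hq0 hq1 hqinv).toLinearMap

lemma f_apply (a : QSA k 2 q) :
    f k q hq0 hq1 hqinv a = rho k q hq0 hq1 hqinv a (Finsupp.single (0, 0) (1 : k)) := rfl

lemma rx_pow (j : ℕ) : (rx k q ^ j) (Finsupp.single (0, 0) (1 : k)) = Finsupp.single (0, j) 1 := by
  induction j with
  | zero => rfl
  | succ j ih => rw [pow_succ', Module.End.mul_apply, ih, rx_single, pow_zero, one_smul]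

lemma ry_pow (i j : ℕ) : (ry k ^ i) (Finsupp.single (0, j) (1 : k)) = Finsupp.single (i, j) 1 := by
  induction i with
  | zero => rfl
  | succ i ih => rw [pow_succ', Module.End.mul_apply, ih, ry_single]

lemma f_g (m : M k) : f k q hq0 hq1 hqinv (g k q m) = m := by
  have : (f k q hq0 hq1 hqinv).comp (g k q) = LinearMap.id := by
    refine Finsupp.lhom_ext ?_
    rintro ⟨i, j⟩ c
    rw [LinearMap.comp_apply, g_single, map_smul, f_apply, map_mul, map_pow, map_pow, rho_X, rho_X]
    show c • (ry k ^ i * rx k q ^ j) _ = _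
    rw [Module.End.mul_apply, rx_pow, ry_pow]
    simp
  exact LinearMap.congr_fun this m

lemma g_rgen (i : Fin 2) (m : M k) : g k q (rgen k q i m) = X k 2 q i * g k q m := by
  induction m using Finsupp.induction_linear with
  | zero => simp
  | add u v hu hv => rw [map_add, map_add, map_add, hu, hv, mul_add]
  | single p c =>
    obtain ⟨a, b⟩ := p
    fin_cases i
    · show g k q (rx k q _) = X k 2 q 0 * _
      rw [rx_single, map_smul, g_single, g_single, mul_smul_comm, ← mul_assoc,
        QPl.x_ypow _ _ _ (hxy k q), smul_mul_assoc, mul_assoc, ← pow_succ', smul_comm]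
    · show g k q (ry k _) = X k 2 q 1 * _
      rw [ry_single, g_single, g_single, mul_smul_comm, ← mul_assoc, ← pow_succ']

lemma g_rho (a : QSA k 2 q) : ∀ m : M k, g k q (rho k q hq0 hq1 hqinv a m) = a * g k q m := by
  obtain ⟨a, rfl⟩ := RingQuot.mkAlgHom_surjective k (QRel k 2 q) a
  induction a using FreeAlgebra.induction with
  | grade0 r =>
    intro m
    rw [AlgHom.commutes, AlgHom.commutes, Module.algebraMap_end_apply, map_smul, Algebra.smul_def]
  | grade1 i =>
    intro m
    have := rho_X k q hq0 hq1 hqinv i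
    rw [X] at this
    rw [this, g_rgen, X]
  | mul a b ha hb =>
    intro m
    rw [map_mul, map_mul, Module.End.mul_apply, ha, hb, mul_assoc]
  | add a b ha hb =>
    intro m
    rw [map_add, map_add, LinearMap.add_apply, map_add, ha, hb, add_mul]

lemma g_f (a : QSA k 2 q) : g k q (f k q hq0 hq1 hqinv a) = a := by
  rw [f_apply, g_rho, g_single]; simp

def bas : Module.Basis (ℕ × ℕ) k (QSA k 2 q) :=
  Module.Basis.ofRepr (LinearEquiv.ofLinear (f k q hq0 hq1 hqinv) (g k q)
    (LinearMap.ext (f_g k q hq0 hq1 hqinv)) (LinearMap.ext (g_f k q hq0 hq1 hqinv)))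

lemma bas_apply (i j : ℕ) :
    bas k q hq0 hq1 hqinv (i, j) = X k 2 q 1 ^ i * X k 2 q 0 ^ j := by
  show g k q (Finsupp.single (i, j) 1) = _
  rw [g_single, one_smul]

lemma hmod (a c d : QSA k 2 q) :
    (a ⊗ₜ[k] MulOpposite.op d : QSAe k 2 q) • c = a * c * d := by
  rw [TensorProduct.Algebra.smul_def, smul_eq_mul, MulOpposite.smul_eq_mul_unop, mul_assoc,
    MulOpposite.unop_op]

end
end QBas

namespace QPl
section
variable {k : Type} [Field k] {A : Type} [Ring A] [Algebra k A] (b : Module.Basis (ℕ × ℕ) k A)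
  (x y : A) (Q : k) (hxy : x * y = Q • (y * x)) (hb : ∀ i j, b (i, j) = y ^ i * x ^ j)
  (hQ : ∀ n, 0 < n → Q ^ n ≠ 1) (hQ0 : Q ≠ 0)
  [Module (A ⊗[k] Aᵐᵒᵖ) A]
  (hmod : ∀ a c d : A, (a ⊗ₜ[k] MulOpposite.op d : A ⊗[k] Aᵐᵒᵖ) • c = a * c * d)

include hxy hb hQ hQ0 hmod

theorem final :
    Module.finrank k (((Ext k (ModuleCat.{0} (A ⊗[k] Aᵐᵒᵖ)) 0).obj
      (Opposite.op (ModuleCat.of (A ⊗[k] Aᵐᵒᵖ) A))).obj (ModuleCat.of (A ⊗[k] Aᵐᵒᵖ) A)) = 1 ∧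
    Module.finrank k (((Ext k (ModuleCat.{0} (A ⊗[k] Aᵐᵒᵖ)) 1).obj
      (Opposite.op (ModuleCat.of (A ⊗[k] Aᵐᵒᵖ) A))).obj (ModuleCat.of (A ⊗[k] Aᵐᵒᵖ) A)) = 2 ∧
    Module.finrank k (((Ext k (ModuleCat.{0} (A ⊗[k] Aᵐᵒᵖ)) 2).obj
      (Opposite.op (ModuleCat.of (A ⊗[k] Aᵐᵒᵖ) A))).obj (ModuleCat.of (A ⊗[k] Aᵐᵒᵖ) A)) = 2 ∧
    ∀ m : ℕ, 3 ≤ m → Subsingleton (((Ext k (ModuleCat.{0} (A ⊗[k] Aᵐᵒᵖ)) m).obj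
      (Opposite.op (ModuleCat.of (A ⊗[k] Aᵐᵒᵖ) A))).obj (ModuleCat.of (A ⊗[k] Aᵐᵒᵖ) A)) := by
  have hto := tower hmod
  let μ : (A ⊗[k] Aᵐᵒᵖ) →ₗ[A ⊗[k] Aᵐᵒᵖ] A := LinearMap.toSpanSingleton (A ⊗[k] Aᵐᵒᵖ) A 1
  have hμa : ∀ r, μ r = r • (1 : A) := fun r => rfl
  have hμ : Function.Surjective μ := by
    intro a
    refine ⟨a ⊗ₜ MulOpposite.op 1, ?_⟩
    rw [hμa, hmod, mul_one, mul_one]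
  have hμs : μ (bet x 1) = 0 := by
    rw [hμa, smul_bet x hmod, mul_one, one_mul, one_smul, sub_self]
  have hμt : μ (tt y) = 0 := by
    rw [hμa, smul_tt y hmod, mul_one, one_mul, sub_self]
  have hs1 : ∀ a : A, (bet x 1 : A ⊗[k] Aᵐᵒᵖ) • a = x * a - a * x := by
    intro a
    rw [smul_bet x hmod, one_smul]
  have hs := bet_reg b x y hb 1
  have hβ := bet_reg b x y hb Q
  have hk := ker_mu b x y hb hmod
  have hv := hvt b x y Q hb hxy
  have h0 := h00 x y Q hxy
  have hbx : b (0, 1) = x := by rw [hb, pow_zero, one_mul, pow_one]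
  have hby : b (1, 0) = y := by rw [hb, pow_zero, mul_one, pow_one]
  have hb1 : b (0, 0) = 1 := by rw [hb, pow_zero, pow_zero, mul_one]
  refine ⟨?_, ?_, ?_, ?_⟩
  · refine Kosz.ext_dim0 _ _ _ _ h0 μ hμ hs hβ hμs hμt hk hv k A 1
      (LinearMap.pi fun _ => b.coord (0, 0)) ?_ ?_
    · intro w
      refine ⟨w 0 • b (0, 0), ?_, ?_, ?_⟩
      · rw [hs1, hb1, mul_smul_comm, smul_mul_assoc, mul_one, one_mul, sub_self]
      · rw [smul_tt y hmod, hb1, mul_smul_comm, smul_mul_assoc, mul_one, one_mul, sub_self]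
      · ext i
        fin_cases i
        simp
    · intro a h1 h2 h3
      rw [hs1] at h1
      rw [smul_tt y hmod] at h2
      exact center b x y Q hxy hb hQ a h1 h2 (congrFun h3 0)
  · refine Kosz.ext_dim1 _ _ _ _ h0 μ hμ hs hβ hμs hμt hk hv k A 2
      (LinearMap.pi ![b.coord (0, 1) ∘ₗ LinearMap.fst k A A,
        b.coord (1, 0) ∘ₗ LinearMap.snd k A A]) ?_ ?_ ?_
    · intro w
      refine ⟨w 0 • b (0, 1), w 1 • b (1, 0), ?_, ?_⟩
      · rw [smul_alp y Q hmod, smul_bet x hmod, hbx, hby]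
        simp only [mul_smul_comm, smul_mul_assoc, hxy, smul_comm Q, sub_self, add_zero]
      · ext i
        fin_cases i <;> simp
    · intro a
      rw [hs1, smul_tt y hmod]
      ext i
      fin_cases i
      · show b.repr (x * a - a * x) (0, 0 + 1) = 0
        rw [map_sub, Finsupp.sub_apply, C_x_mul b x y Q hxy hb, C_mul_x b x y hb, pow_zero, one_mul,
          sub_self]
      · show b.repr (y * a - a * y) (0 + 1, 0) = 0
        rw [map_sub, Finsupp.sub_apply, C_mul_y b x y Q hxy hb, C_y_mul b x y hb, pow_zero, one_mul,
          sub_self]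
    · intro a a' h1 h2
      rw [smul_alp y Q hmod, smul_bet x hmod] at h1
      obtain ⟨c, hc⟩ := cocycle b x y Q hxy hb hQ hQ0 a a' h1 (congrFun h2 0) (congrFun h2 1)
      exact ⟨c, by rw [hs1, smul_tt y hmod]; exact hc⟩
  · refine Kosz.ext_dim2 _ _ _ _ h0 μ hμ hs hβ hμs hμt hk hv k A 2
      (LinearMap.pi ![b.coord (0, 0), b.coord (1, 1)]) ?_ ?_ ?_
    · intro w
      refine ⟨w 0 • b (0, 0) + w 1 • b (1, 1), ?_⟩
      ext i
      fin_cases i <;> simp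
    · intro a a'
      rw [smul_alp y Q hmod, smul_bet x hmod]
      ext i
      fin_cases i
      · show b.repr _ (0, 0) = 0
        simp only [map_add, map_sub, map_smul, Finsupp.add_apply, Finsupp.sub_apply,
          Finsupp.smul_apply, C_x_mul0 b x y Q hxy hb, C_mul_x0 b x y hb, C_y_mul0 b x y hb,
          C_mul_y0 b x y Q hxy hb, smul_zero, sub_zero, add_zero]
      · show b.repr _ (0 + 1, 0 + 1) = 0
        simp only [map_add, map_sub, map_smul, Finsupp.add_apply, Finsupp.sub_apply,
          Finsupp.smul_apply, C_x_mul b x y Q hxy hb, C_mul_x b x y hb, C_y_mul b x y hb,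
          C_mul_y b x y Q hxy hb, zero_add, pow_one, smul_eq_mul, sub_self]
    · intro c h
      obtain ⟨a, a', hc⟩ := coker b x y Q hxy hb hQ hQ0 c (congrFun h 0) (congrFun h 1)
      exact ⟨a, a', by rw [smul_alp y Q hmod, smul_bet x hmod]; exact hc⟩
  · intro m hm
    exact Kosz.ext_zero _ _ _ _ h0 μ hμ hs hβ hμs hμt hk hv k A m hm

end
end QPl

/-- Example 4.3 (first case) of the paper: for `N = 2` and `q := q_{1,2}` not a root of
unity, `HH^0(S_q(V)) ≅ k` is 1-dimensional, `HH^1(S_q(V))` is 2-dimensional (spanned by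
the classes of `x_1 ⊗ x_1^*` and `x_2 ⊗ x_2^*`), `HH^2(S_q(V))` is 2-dimensional
(spanned by the classes of `1 ⊗ x_1^* ∧ x_2^*` and `x_1x_2 ⊗ x_1^* ∧ x_2^*`), and
`HH^m(S_q(V)) = 0` for `m ≥ 3`. -/
theorem stmt18 (k : Type) [Field k] [CharZero k]
    (q : Fin 2 → Fin 2 → k) (hq0 : ∀ i j, q i j ≠ 0) (hq1 : ∀ i, q i i = 1)
    (hqinv : ∀ i j, q j i = (q i j)⁻¹)
    (hroot : ¬∃ n : ℕ, 0 < n ∧ q 0 1 ^ n = 1) :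
    Module.finrank k (HH k 2 q 0) = 1 ∧
    Module.finrank k (HH k 2 q 1) = 2 ∧
    Module.finrank k (HH k 2 q 2) = 2 ∧
    (∀ m : ℕ, 3 ≤ m → Subsingleton (HH k 2 q m)) := by
  refine QPl.final (QBas.bas k q hq0 hq1 hqinv) (X k 2 q 0) (X k 2 q 1) (q 0 1) (QBas.hxy k q)
    (QBas.bas_apply k q hq0 hq1 hqinv) ?_ (hq0 0 1) (QBas.hmod k q)
  intro n hn h
  exact hroot ⟨n, hn, h⟩
end
end
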